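/- There exist absolute constants c, C > 0 such that the following holds. If σ ≤ c·(σ_min(A)/κ⁴)·√n/(√(nd)+√m+√(2γ n log n)), then with probability at least 1 − C·n^{−γ+2} the spectral estimator S⁰ = P_n(U) satisfies min_{Q∈O(d)} max_{1≤i≤n} ‖S_i⁰ − O_i Q‖ ≤ C·(σκ²/σ_min(A))·(√(nd)+√m+√(2γ n log n))/√n, where ‖·‖ is the operator norm and S_i⁰ is the i-th d×d block of S⁰. -/

import Mathlib

open MeasureTheory Matrix Filter

namespace GOPP

/-- Frobenius norm of a real matrix. -/
noncomputable def frob {α β : Type*} [Fintype α] [Fintype β] (X : Matrix α β ℝ) : ℝ :=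
  Real.sqrt (∑ i, ∑ j, X i j ^ 2)

/-- Euclidean norm of a vector. -/
noncomputable def vnorm {β : Type*} [Fintype β] (v : β → ℝ) : ℝ :=
  Real.sqrt (∑ j, v j ^ 2)

/-- Operator (spectral) norm: the supremum of ‖Xu‖ over unit vectors u. -/
noncomputable def opNorm {α β : Type*} [Fintype α] [Fintype β] (X : Matrix α β ℝ) : ℝ :=
  sSup {r : ℝ | ∃ u : β → ℝ, vnorm u = 1 ∧ r = vnorm (X.mulVec u)}

/-- Smallest singular value: the infimum of ‖uᵀX‖ over unit vectors u (for a d×m matrix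
with d ≤ m this is the d-th largest singular value; for square matrices it is σ_min). -/
noncomputable def sigmaMin {α β : Type*} [Fintype α] [Fintype β] (X : Matrix α β ℝ) : ℝ :=
  sInf {r : ℝ | ∃ u : α → ℝ, vnorm u = 1 ∧ r = vnorm (Matrix.vecMul u X)}

/-- Condition number κ = σ_max/σ_min. -/
noncomputable def kappa {d m : ℕ} (A : Matrix (Fin d) (Fin m) ℝ) : ℝ :=
  opNorm A / sigmaMin A

/-- Q is an orthogonal matrix. -/
def IsOrth {d : ℕ} (Q : Matrix (Fin d) (Fin d) ℝ) : Prop :=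
  Qᵀ * Q = 1 ∧ Q * Qᵀ = 1

/-- Nuclear norm, via the dual characterization ‖M‖_* = max_{Q ∈ O(d)} ⟨Q, M⟩. -/
noncomputable def nuclearNorm {d : ℕ} (M : Matrix (Fin d) (Fin d) ℝ) : ℝ :=
  sSup {r : ℝ | ∃ Q : Matrix (Fin d) (Fin d) ℝ, IsOrth Q ∧ r = Matrix.trace (Qᵀ * M)}

/-- The i-th d×k block of an (nd)×k block matrix. -/
def blk {n d k : ℕ} (S : Matrix (Fin n × Fin d) (Fin k) ℝ) (i : Fin n) :
    Matrix (Fin d) (Fin k) ℝ :=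
  Matrix.of fun a b => S (i, a) b

/-- The i-th diagonal d×d block of an (nd)×(nd) matrix. -/
def dblk {n d : ℕ} (G : Matrix (Fin n × Fin d) (Fin n × Fin d) ℝ) (i : Fin n) :
    Matrix (Fin d) (Fin d) ℝ :=
  Matrix.of fun a b => G (i, a) (i, b)

/-- S ∈ O(d)^{⊗n}: each of the n d×d blocks of S is orthogonal. -/
def OrthBlocks {n d : ℕ} (S : Matrix (Fin n × Fin d) (Fin d) ℝ) : Prop :=
  ∀ i, IsOrth (blk S i)

/-- Z ∈ ℝ^{nd×d}: the vertical stack of n copies of I_d. -/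
def ZStack (n d : ℕ) : Matrix (Fin n × Fin d) (Fin d) ℝ :=
  Matrix.of fun p j => if p.2 = j then 1 else 0

/-- Vertical stack of n given d×k matrices. -/
def stack {n d k : ℕ} (B : Fin n → Matrix (Fin d) (Fin k) ℝ) :
    Matrix (Fin n × Fin d) (Fin k) ℝ :=
  Matrix.of fun p b => B p.1 p.2 b

/-- d_F(X,Y) = min_{Q ∈ O(d)} ‖X − YQ‖_F. -/
noncomputable def dF {n d : ℕ} (X Y : Matrix (Fin n × Fin d) (Fin d) ℝ) : ℝ :=
  sInf {r : ℝ | ∃ Q, IsOrth Q ∧ r = frob (X - Y * Q)}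

/-- R is a polar factor P(X) of X: an orthogonal global minimizer of ‖X − Q‖_F over O(d). -/
def IsPolar {d : ℕ} (X R : Matrix (Fin d) (Fin d) ℝ) : Prop :=
  IsOrth R ∧ ∀ Q : Matrix (Fin d) (Fin d) ℝ, IsOrth Q → frob (X - R) ≤ frob (X - Q)

/-- S = P_n(X): blockwise polar factor. -/
def IsPolarBlocks {n d : ℕ} (X S : Matrix (Fin n × Fin d) (Fin d) ℝ) : Prop :=
  ∀ i, IsPolar (blk X i) (blk S i)

/-- U collects (an orthonormal basis of the span of) the top d left singular vectors of D:
U has orthonormal columns and maximizes the Ky Fan quantity trace(Uᵀ(DDᵀ)U). -/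
def IsTopSingVecs {N : Type*} [Fintype N] {d m : ℕ} (D : Matrix N (Fin m) ℝ)
    (U : Matrix N (Fin d) ℝ) : Prop :=
  Uᵀ * U = 1 ∧ ∀ Q : Matrix N (Fin d) ℝ, Qᵀ * Q = 1 →
    Matrix.trace (Qᵀ * (D * Dᵀ) * Q) ≤ Matrix.trace (Uᵀ * (D * Dᵀ) * U)

/-- (U, S, V) is a top-d singular triple of D: orthonormal U, V, diagonal nonnegative S,
DV = US, DᵀU = VS, and U spans a top-d left singular subspace. -/
def IsSVDTriple {N : Type*} [Fintype N] {d m : ℕ} (D : Matrix N (Fin m) ℝ)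
    (U : Matrix N (Fin d) ℝ) (S : Matrix (Fin d) (Fin d) ℝ)
    (V : Matrix (Fin m) (Fin d) ℝ) : Prop :=
  Vᵀ * V = 1 ∧ (∀ a b, a ≠ b → S a b = 0) ∧ (∀ a, 0 ≤ S a a) ∧
    D * V = U * S ∧ Dᵀ * U = V * S ∧ IsTopSingVecs D U

/-- The generalized power method sequence with spectral initialization, run on the data
matrix D (so with C = DDᵀ): S⁰ = P_n(U) for top singular vectors U of D, and
S^{t+1} = P_n(C Sᵗ). -/
def IsGPM {n d m : ℕ} (D : Matrix (Fin n × Fin d) (Fin m) ℝ)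
    (S : ℕ → Matrix (Fin n × Fin d) (Fin d) ℝ) : Prop :=
  (∃ U, IsTopSingVecs D U ∧ IsPolarBlocks U (S 0)) ∧
    ∀ t, IsPolarBlocks (D * Dᵀ * S t) (S (t + 1))

/-- W^(i): W with its i-th block row replaced by 0. -/
def mask {n d m : ℕ} (W : Matrix (Fin n × Fin d) (Fin m) ℝ) (i : Fin n) :
    Matrix (Fin n × Fin d) (Fin m) ℝ :=
  Matrix.of fun p b => if p.1 = i then 0 else W p b

/-- The noise matrix Δ = WAᵀZᵀ + ZAWᵀ + σWWᵀ. -/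
noncomputable def delta {n d m : ℕ} (A : Matrix (Fin d) (Fin m) ℝ)
    (W : Matrix (Fin n × Fin d) (Fin m) ℝ) (σ : ℝ) :
    Matrix (Fin n × Fin d) (Fin n × Fin d) ℝ :=
  W * Aᵀ * (ZStack n d)ᵀ + ZStack n d * A * Wᵀ + σ • (W * Wᵀ)

/-- The i-th block column Δ_i = WAᵀ + ZAW_iᵀ + σWW_iᵀ of Δ. -/
noncomputable def deltaCol {n d m : ℕ} (A : Matrix (Fin d) (Fin m) ℝ)
    (W : Matrix (Fin n × Fin d) (Fin m) ℝ) (σ : ℝ) (i : Fin n) :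
    Matrix (Fin n × Fin d) (Fin d) ℝ :=
  W * Aᵀ + ZStack n d * A * (blk W i)ᵀ + σ • (W * (blk W i)ᵀ)

/-- The operator L S = C S/(n‖A‖²) with C = ZAAᵀZᵀ + σΔ. -/
noncomputable def Lop {n d m : ℕ} (A : Matrix (Fin d) (Fin m) ℝ)
    (W : Matrix (Fin n × Fin d) (Fin m) ℝ) (σ : ℝ)
    (S : Matrix (Fin n × Fin d) (Fin d) ℝ) : Matrix (Fin n × Fin d) (Fin d) ℝ :=
  ((n : ℝ) * opNorm A ^ 2)⁻¹ •
    ((ZStack n d * A * Aᵀ * (ZStack n d)ᵀ + σ • delta A W σ) * S)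

/-- √(nd) + √m + √(2γ n log n). -/
noncomputable def bnd1 (n d m : ℕ) (γ : ℝ) : ℝ :=
  Real.sqrt ((n : ℝ) * d) + Real.sqrt (m : ℝ) + Real.sqrt (2 * γ * n * Real.log n)

/-- √(nd) + √m + √(2γ log n). -/
noncomputable def bnd2 (n d m : ℕ) (γ : ℝ) : ℝ :=
  Real.sqrt ((n : ℝ) * d) + Real.sqrt (m : ℝ) + Real.sqrt (2 * γ * Real.log n)

/-- The basin of attraction N_ε. -/
def memNeps {n d : ℕ} (ε : ℝ) (S : Matrix (Fin n × Fin d) (Fin d) ℝ) : Prop :=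
  OrthBlocks S ∧ dF S (ZStack n d) ≤ ε * Real.sqrt ((n : ℝ) * d)

/-- The basin of attraction N_{ξ,∞}. -/
def memNxi {n d m : ℕ} (W : Matrix (Fin n × Fin d) (Fin m) ℝ) (γ ξ : ℝ)
    (S : Matrix (Fin n × Fin d) (Fin d) ℝ) : Prop :=
  OrthBlocks S ∧ ∀ i, frob (blk W i * Wᵀ * S) ≤ ξ * Real.sqrt (d : ℝ) * bnd1 n d m γ ^ 2

/-- The distribution of a matrix with i.i.d. standard Gaussian N(0,1) entries. -/
noncomputable def stdGaussian (ι κ : Type*) [Fintype ι] [Fintype κ] :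
    Measure (ι → κ → ℝ) :=
  Measure.pi fun _ : ι => Measure.pi fun _ : κ => ProbabilityTheory.gaussianReal 0 1

section Euclidean

variable {ι κ : Type*} [Fintype ι] [Fintype κ]

theorem vnorm_eq_norm (v : ι → ℝ) : vnorm v = ‖WithLp.toLp 2 v‖ := by
  simp [vnorm, EuclideanSpace.norm_eq]

theorem vnorm_nonneg (v : ι → ℝ) : 0 ≤ vnorm v := Real.sqrt_nonneg _

theorem vnorm_sq (v : ι → ℝ) : vnorm v ^ 2 = v ⬝ᵥ v := by
  rw [vnorm, Real.sq_sqrt (by positivity)]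
  simp [dotProduct, sq]

theorem vnorm_add_le (v w : ι → ℝ) : vnorm (v + w) ≤ vnorm v + vnorm w := by
  simpa [vnorm_eq_norm] using norm_add_le (WithLp.toLp 2 v) (WithLp.toLp 2 w)

theorem vnorm_sub_le (v w : ι → ℝ) : vnorm v - vnorm w ≤ vnorm (v + w) := by
  simpa [vnorm_eq_norm] using norm_sub_le_norm_add (WithLp.toLp 2 v) (WithLp.toLp 2 w)

theorem vnorm_smul (c : ℝ) (v : ι → ℝ) : vnorm (c • v) = |c| * vnorm v := by
  simpa [vnorm_eq_norm] using norm_smul c (WithLp.toLp 2 v)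

theorem vnorm_eq_zero {v : ι → ℝ} : vnorm v = 0 ↔ v = 0 := by
  simp [vnorm_eq_norm]

theorem vnorm_pos {v : ι → ℝ} (hv : v ≠ 0) : 0 < vnorm v :=
  (vnorm_nonneg v).lt_of_ne fun h => hv (vnorm_eq_zero.1 h.symm)

theorem dotProduct_le_vnorm (v w : ι → ℝ) : v ⬝ᵥ w ≤ vnorm v * vnorm w := by
  have := real_inner_le_norm (WithLp.toLp 2 w) (WithLp.toLp 2 v)
  rw [vnorm_eq_norm, vnorm_eq_norm, mul_comm]
  simpa [PiLp.inner_apply, dotProduct] using this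

theorem vnorm_normalize {v : ι → ℝ} (hv : v ≠ 0) : vnorm ((vnorm v)⁻¹ • v) = 1 := by
  rw [vnorm_smul, abs_of_nonneg (inv_nonneg.2 (vnorm_nonneg v)), inv_mul_cancel₀ (vnorm_pos hv).ne']

end Euclidean

section OperatorNorm

open scoped Matrix.Norms.L2Operator

variable {ι κ : Type*} [Fintype ι] [Fintype κ]

theorem vnorm_mulVec_le [DecidableEq κ] (X : Matrix ι κ ℝ) (v : κ → ℝ) :
    vnorm (X *ᵥ v) ≤ ‖X‖ * vnorm v := by
  simpa [vnorm_eq_norm] using X.l2_opNorm_mulVec (WithLp.toLp 2 v)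

theorem norm_le_of_vnorm_mulVec_le [DecidableEq κ] {X : Matrix ι κ ℝ} {c : ℝ} (hc : 0 ≤ c)
    (h : ∀ v, vnorm (X *ᵥ v) ≤ c * vnorm v) : ‖X‖ ≤ c := by
  rw [l2_opNorm_def]
  refine ContinuousLinearMap.opNorm_le_bound _ hc fun v => ?_
  have := h v.ofLp
  rw [vnorm_eq_norm, vnorm_eq_norm] at this
  exact this

theorem norm_transpose [DecidableEq κ] [DecidableEq ι] (X : Matrix ι κ ℝ) : ‖Xᵀ‖ = ‖X‖ := by
  rw [← l2_opNorm_conjTranspose X, conjTranspose_eq_transpose_of_trivial]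

theorem opNorm_le_norm [DecidableEq κ] (X : Matrix ι κ ℝ) : opNorm X ≤ ‖X‖ := by
  refine Real.sSup_le ?_ (norm_nonneg _)
  rintro r ⟨u, hu, rfl⟩
  simpa [hu] using vnorm_mulVec_le X u

theorem opNorm_nonneg (X : Matrix ι κ ℝ) : 0 ≤ opNorm X := by
  refine Real.sSup_nonneg ?_
  rintro r ⟨u, -, rfl⟩
  exact vnorm_nonneg _

theorem norm_le_opNorm [DecidableEq κ] (X : Matrix ι κ ℝ) : ‖X‖ ≤ opNorm X := by
  refine norm_le_of_vnorm_mulVec_le (opNorm_nonneg X) fun v => ?_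
  rcases eq_or_ne v 0 with rfl | hv
  · simp [vnorm_eq_norm]
  have hbdd : BddAbove {r : ℝ | ∃ u : κ → ℝ, vnorm u = 1 ∧ r = vnorm (X.mulVec u)} := by
    refine ⟨‖X‖, ?_⟩
    rintro r ⟨u, hu, rfl⟩
    simpa [hu] using vnorm_mulVec_le X u
  have := le_csSup hbdd ⟨_, vnorm_normalize hv, rfl⟩
  rw [mulVec_smul, vnorm_smul, abs_of_nonneg (inv_nonneg.2 (vnorm_nonneg v)),
    inv_mul_le_iff₀ (vnorm_pos hv)] at this
  rwa [mul_comm]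

theorem sigmaMin_mul_vnorm_le (X : Matrix ι κ ℝ) (v : ι → ℝ) :
    sigmaMin X * vnorm v ≤ vnorm (Xᵀ *ᵥ v) := by
  rcases eq_or_ne v 0 with rfl | hv
  · simp [vnorm_eq_norm]
  have hbdd : BddBelow {r : ℝ | ∃ u : ι → ℝ, vnorm u = 1 ∧ r = vnorm (Matrix.vecMul u X)} := by
    refine ⟨0, ?_⟩
    rintro r ⟨u, -, rfl⟩
    exact vnorm_nonneg _
  have := csInf_le hbdd ⟨_, vnorm_normalize hv, rfl⟩
  rw [← mulVec_transpose, mulVec_smul, vnorm_smul,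
    abs_of_nonneg (inv_nonneg.2 (vnorm_nonneg v)), ← div_eq_inv_mul,
    le_div_iff₀ (vnorm_pos hv)] at this
  exact this

theorem norm_le_one_of_transpose_mul_self [DecidableEq κ] {X : Matrix ι κ ℝ}
    (h : Xᵀ * X = 1) : ‖X‖ ≤ 1 := by
  refine norm_le_of_vnorm_mulVec_le zero_le_one fun v => le_of_eq ?_
  rw [one_mul, ← sq_eq_sq₀ (vnorm_nonneg _) (vnorm_nonneg _), vnorm_sq, vnorm_sq, dotProduct_mulVec,
    vecMul_mulVec, h]
  simp

end OperatorNorm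

section TopEigenspace

variable {ι κ : Type*} [Fintype ι] [Fintype κ]

theorem dotProduct_mulVec_comm {G : Matrix ι ι ℝ} (hG : G.IsSymm) (v w : ι → ℝ) :
    v ⬝ᵥ G *ᵥ w = w ⬝ᵥ G *ᵥ v := by
  rw [dotProduct_mulVec, ← mulVec_transpose, hG.eq, dotProduct_comm]

theorem transpose_mulVec_dotProduct (X : Matrix ι κ ℝ) (v : ι → ℝ) (w : κ → ℝ) :
    (Xᵀ *ᵥ v) ⬝ᵥ w = v ⬝ᵥ X *ᵥ w := by
  rw [mulVec_transpose, dotProduct_mulVec]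

theorem dotProduct_transpose_mulVec (X : Matrix ι κ ℝ) (v : ι → ℝ) (w : κ → ℝ) :
    w ⬝ᵥ (Xᵀ *ᵥ v) = (X *ᵥ w) ⬝ᵥ v := by
  rw [dotProduct_comm, transpose_mulVec_dotProduct, dotProduct_comm]

variable [DecidableEq κ]

/-- `U` has orthonormal columns and maximizes `trace (Uᵀ G U)`. -/
def IsTopEig (G : Matrix ι ι ℝ) (U : Matrix ι κ ℝ) : Prop :=
  Uᵀ * U = 1 ∧ ∀ Q : Matrix ι κ ℝ, Qᵀ * Q = 1 →
    Matrix.trace (Qᵀ * G * Q) ≤ Matrix.trace (Uᵀ * G * U)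

open scoped Matrix.Norms.L2Operator in
theorem isCompact_stiefel : IsCompact {U : Matrix ι κ ℝ | Uᵀ * U = 1} := by
  have : ProperSpace (Matrix ι κ ℝ) := FiniteDimensional.proper ℝ _
  refine Metric.isCompact_of_isClosed_isBounded ?_ ?_
  · exact isClosed_eq (by fun_prop) continuous_const
  · refine isBounded_iff_forall_norm_le.2 ⟨1, fun U hU => norm_le_one_of_transpose_mul_self hU⟩

theorem exists_isTopEig (G : Matrix ι ι ℝ) (h : ∃ U : Matrix ι κ ℝ, Uᵀ * U = 1) :
    ∃ U : Matrix ι κ ℝ, IsTopEig G U := by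
  obtain ⟨U, hU, hmax⟩ := isCompact_stiefel.exists_isMaxOn h
    (f := fun U : Matrix ι κ ℝ => Matrix.trace (Uᵀ * G * U)) (by fun_prop)
  exact ⟨U, hU, fun Q hQ => hmax hQ⟩

theorem dotProduct_mulVec_of_transpose_mul_self {U : Matrix ι κ ℝ} (hU : Uᵀ * U = 1)
    (a b : κ → ℝ) : (U *ᵥ a) ⬝ᵥ (U *ᵥ b) = a ⬝ᵥ b := by
  rw [← dotProduct_transpose_mulVec, mulVec_mulVec, hU, one_mulVec]

theorem eq_zero_of_forall_circle {p x : ℝ}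
    (h : ∀ c s : ℝ, c ^ 2 + s ^ 2 = 1 → s ^ 2 * p + c * s * x ≤ 0) : x = 0 := by
  have key : ∀ t : ℝ, t ^ 2 * p + t * x ≤ 0 := by
    intro t
    have h1 : 0 < 1 + t ^ 2 := by positivity
    have h2 : Real.sqrt (1 + t ^ 2) ^ 2 = 1 + t ^ 2 := Real.sq_sqrt h1.le
    have h3 : Real.sqrt (1 + t ^ 2) ≠ 0 := (Real.sqrt_pos.2 h1).ne'
    have := h (Real.sqrt (1 + t ^ 2))⁻¹ (t * (Real.sqrt (1 + t ^ 2))⁻¹) (by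
      field_simp
      rw [h2])
    have h4 : (t * (Real.sqrt (1 + t ^ 2))⁻¹) ^ 2 * p
        + (Real.sqrt (1 + t ^ 2))⁻¹ * (t * (Real.sqrt (1 + t ^ 2))⁻¹) * x
        = (t ^ 2 * p + t * x) / (1 + t ^ 2) := by
      rw [mul_pow, inv_pow, h2, mul_left_comm, ← mul_inv, ← sq, h2]
      field_simp
    rw [h4] at this
    by_contra hcon
    exact absurd this (not_le.2 (div_pos (not_le.1 hcon) h1))
  have h1 := key (x / (1 + |p|))
  have h0 : 0 < 1 + |p| := by positivity
  have h2 : (x / (1 + |p|)) ^ 2 * p + x / (1 + |p|) * x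
      = x ^ 2 * (p + 1 + |p|) / (1 + |p|) ^ 2 := by
    field_simp
    ring
  rw [h2, div_nonpos_iff] at h1
  have h3 : 0 < (1 + |p|) ^ 2 := by positivity
  have h4 : 1 ≤ p + 1 + |p| := by linarith [neg_abs_le p]
  rcases h1 with h1 | h1
  · linarith [h1.2]
  · have : x ^ 2 ≤ 0 := by nlinarith [h1.1, sq_nonneg x]
    exact pow_eq_zero_iff (two_ne_zero) |>.1 (le_antisymm this (sq_nonneg x))

variable {G : Matrix ι ι ℝ} {U : Matrix ι κ ℝ}

theorem IsTopEig.le_of_transpose_mulVec (hU : IsTopEig G U) (hG : G.IsSymm) {a : κ → ℝ}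
    (ha : a ⬝ᵥ a = 1) {z : ι → ℝ} (hz : z ⬝ᵥ z = 1) {r : ℝ} (hzU : Uᵀ *ᵥ z = r • a) :
    z ⬝ᵥ G *ᵥ z ≤ (U *ᵥ a) ⬝ᵥ G *ᵥ (U *ᵥ a) := by
  set y : ι → ℝ := z - U *ᵥ a with hy
  have h1 : Uᵀ *ᵥ y = (r - 1) • a := by
    rw [hy, mulVec_sub, hzU, mulVec_mulVec, hU.1, one_mulVec, sub_smul, one_smul]
  have hzUa : z ⬝ᵥ (U *ᵥ a) = r := by
    rw [← transpose_mulVec_dotProduct, hzU, smul_dotProduct, ha, smul_eq_mul, mul_one]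
  have h2 : y ⬝ᵥ y = 2 - 2 * r := by
    have := dotProduct_mulVec_of_transpose_mul_self hU.1 a a
    rw [hy]
    simp only [sub_dotProduct, dotProduct_sub]
    rw [dotProduct_comm (U *ᵥ a) z, hzUa, this, ha, hz]
    ring
  have hQ : (U + vecMulVec y a)ᵀ * (U + vecMulVec y a) = 1 := by
    rw [transpose_add, transpose_vecMulVec, Matrix.add_mul, Matrix.mul_add, Matrix.mul_add, hU.1,
      mul_vecMulVec, vecMulVec_mul, vecMulVec_mul_vecMulVec, ← mulVec_transpose, h1, h2,
      smul_vecMulVec, vecMulVec_smul, vecMulVec_smul]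
    module
  have htr := hU.2 _ hQ
  have h3 : trace ((U + vecMulVec y a)ᵀ * G * (U + vecMulVec y a))
      = trace (Uᵀ * G * U) + (2 * (y ⬝ᵥ G *ᵥ (U *ᵥ a)) + y ⬝ᵥ G *ᵥ y) := by
    rw [transpose_add, transpose_vecMulVec, Matrix.add_mul, Matrix.add_mul, Matrix.mul_add,
      Matrix.mul_add, mul_vecMulVec, vecMulVec_mul, vecMulVec_mul, vecMulVec_mul_vecMulVec]
    simp only [trace_add, trace_vecMulVec, smul_eq_mul, vecMulVec_smul,
      trace_smul, ha, ← mulVec_transpose, hG.eq, ← mulVec_mulVec, dotProduct_transpose_mulVec,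
      transpose_mulVec_dotProduct]
    rw [dotProduct_comm (G *ᵥ y), dotProduct_mulVec_comm hG (U *ᵥ a) y,
      dotProduct_comm (G *ᵥ y) y]
    ring
  have h4 : 2 * (y ⬝ᵥ G *ᵥ (U *ᵥ a)) + y ⬝ᵥ G *ᵥ y
      = z ⬝ᵥ G *ᵥ z - (U *ᵥ a) ⬝ᵥ G *ᵥ (U *ᵥ a) := by
    rw [hy]
    simp only [mulVec_sub, sub_dotProduct, dotProduct_sub]
    rw [dotProduct_mulVec_comm hG (U *ᵥ a) z]
    ring
  linarith

theorem IsTopEig.compl_le (hU : IsTopEig G U) (hG : G.IsSymm) {w : ι → ℝ} (hw : Uᵀ *ᵥ w = 0)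
    (a : κ → ℝ) :
    (a ⬝ᵥ a) * (w ⬝ᵥ G *ᵥ w) ≤ (w ⬝ᵥ w) * ((U *ᵥ a) ⬝ᵥ G *ᵥ (U *ᵥ a)) := by
  rcases eq_or_ne a 0 with rfl | ha
  · simp
  rcases eq_or_ne w 0 with rfl | hw0
  · simp
  have h1 : ((vnorm a)⁻¹ • a) ⬝ᵥ ((vnorm a)⁻¹ • a) = 1 := by
    rw [← vnorm_sq, vnorm_normalize ha, one_pow]
  have h2 : ((vnorm w)⁻¹ • w) ⬝ᵥ ((vnorm w)⁻¹ • w) = 1 := by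
    rw [← vnorm_sq, vnorm_normalize hw0, one_pow]
  have := hU.le_of_transpose_mulVec hG h1 h2 (r := 0) (by rw [mulVec_smul, hw]; simp)
  simp only [mulVec_smul, smul_dotProduct, dotProduct_smul, smul_eq_mul] at this
  have ha' := vnorm_pos ha
  have hw' := vnorm_pos hw0
  rw [← mul_assoc, ← mul_assoc, ← mul_inv, ← mul_inv, ← sq, ← sq, inv_mul_le_iff₀ (by positivity),
    ← mul_assoc, mul_comm (vnorm w ^ 2), mul_assoc, ← div_eq_inv_mul,
    le_div_iff₀ (by positivity)] at this
  rw [← vnorm_sq, ← vnorm_sq]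
  linarith

theorem IsTopEig.dotProduct_eq_zero (hU : IsTopEig G U) (hG : G.IsSymm) {w : ι → ℝ}
    (hw : Uᵀ *ᵥ w = 0) (a : κ → ℝ) : w ⬝ᵥ G *ᵥ (U *ᵥ a) = 0 := by
  rcases eq_or_ne a 0 with rfl | ha0
  · simp
  rcases eq_or_ne w 0 with rfl | hw0
  · simp
  have of_unit : ∀ (a : κ → ℝ) (w : ι → ℝ), a ⬝ᵥ a = 1 → w ⬝ᵥ w = 1 → Uᵀ *ᵥ w = 0 →
      w ⬝ᵥ G *ᵥ (U *ᵥ a) = 0 := by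
    intro a w ha hw1 hw
    have hUa : (U *ᵥ a) ⬝ᵥ (U *ᵥ a) = 1 := by
      rw [dotProduct_mulVec_of_transpose_mul_self hU.1, ha]
    have hUw : w ⬝ᵥ (U *ᵥ a) = 0 := by rw [← transpose_mulVec_dotProduct, hw, zero_dotProduct]
    have : 2 * (w ⬝ᵥ G *ᵥ (U *ᵥ a)) = 0 := by
      refine eq_zero_of_forall_circle
        (p := w ⬝ᵥ G *ᵥ w - (U *ᵥ a) ⬝ᵥ G *ᵥ (U *ᵥ a)) fun c s hcs => ?_
      have h := hU.le_of_transpose_mulVec hG ha (z := c • (U *ᵥ a) + s • w) (r := c) ?_ ?_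
      · simp only [mulVec_add, mulVec_smul, add_dotProduct, dotProduct_add, smul_dotProduct,
          dotProduct_smul, smul_eq_mul] at h
        rw [dotProduct_mulVec_comm hG (U *ᵥ a) w] at h
        linear_combination h - (U *ᵥ a) ⬝ᵥ G *ᵥ (U *ᵥ a) * hcs
      · simp only [add_dotProduct, dotProduct_add, smul_dotProduct, dotProduct_smul, smul_eq_mul]
        rw [dotProduct_comm (U *ᵥ a) w, hUw, hUa, hw1]
        linear_combination hcs
      · rw [mulVec_add, mulVec_smul, mulVec_smul, hw, mulVec_mulVec, hU.1, one_mulVec]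
        simp
    linarith
  have h1 : ((vnorm a)⁻¹ • a) ⬝ᵥ ((vnorm a)⁻¹ • a) = 1 := by
    rw [← vnorm_sq, vnorm_normalize ha0, one_pow]
  have h2 : ((vnorm w)⁻¹ • w) ⬝ᵥ ((vnorm w)⁻¹ • w) = 1 := by
    rw [← vnorm_sq, vnorm_normalize hw0, one_pow]
  have := of_unit _ _ h1 h2 (by rw [mulVec_smul, hw, smul_zero])
  simp only [mulVec_smul, smul_dotProduct, dotProduct_smul, smul_eq_mul, mul_eq_zero,
    inv_eq_zero, (vnorm_pos ha0).ne', (vnorm_pos hw0).ne', false_or] at this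
  exact this

theorem IsTopEig.mul_eq (hU : IsTopEig G U) (hG : G.IsSymm) : G * U = U * (Uᵀ * G * U) := by
  refine ext_of_mulVec_single fun j => ?_
  set a : κ → ℝ := Pi.single j 1
  rw [← sub_eq_zero]
  set w := (G * U) *ᵥ a - (U * (Uᵀ * G * U)) *ᵥ a with hw
  have hw0 : Uᵀ *ᵥ w = 0 := by
    rw [hw, mulVec_sub, mulVec_mulVec, mulVec_mulVec, ← Matrix.mul_assoc Uᵀ U, hU.1,
      Matrix.one_mul, Matrix.mul_assoc, sub_self]
  have h1 := hU.dotProduct_eq_zero hG hw0 a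
  have h2 : w ⬝ᵥ w = 0 := by
    conv_lhs => rw [hw, dotProduct_sub]
    rw [← hw, ← mulVec_mulVec, h1, ← mulVec_mulVec, ← transpose_mulVec_dotProduct, hw0,
      zero_dotProduct, sub_zero]
  rw [← vnorm_sq, sq_eq_zero_iff, vnorm_eq_zero] at h2
  exact h2

end TopEigenspace

section SpectralGap

open scoped Matrix.Norms.L2Operator

variable {ι κ : Type*} [Fintype ι] [Fintype κ] [DecidableEq κ]

/-- The columns of `V` form an orthonormal basis of an invariant subspace of `G` on which the
quadratic form of `G` is at least `lo`, while it is at most `hi` on the orthogonal complement. -/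
structure SpectralGap (G : Matrix ι ι ℝ) (V : Matrix ι κ ℝ) (lo hi : ℝ) : Prop where
  orthonormal : Vᵀ * V = 1
  invariant : G * V = V * (Vᵀ * G * V)
  lower : ∀ a, lo * (a ⬝ᵥ a) ≤ (V *ᵥ a) ⬝ᵥ G *ᵥ (V *ᵥ a)
  upper : ∀ w, Vᵀ *ᵥ w = 0 → w ⬝ᵥ G *ᵥ w ≤ hi * (w ⬝ᵥ w)

variable {G : Matrix ι ι ℝ} {U : Matrix ι κ ℝ}

theorem IsTopEig.lower_bound (hU : IsTopEig G U) (hG : G.IsSymm) {T : Matrix ι κ ℝ} {lo : ℝ}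
    (hT : ∀ y, lo * ((T *ᵥ y) ⬝ᵥ (T *ᵥ y)) ≤ (T *ᵥ y) ⬝ᵥ G *ᵥ (T *ᵥ y))
    (hinj : ∀ y, T *ᵥ y = 0 → y = 0) (a : κ → ℝ) :
    lo * (a ⬝ᵥ a) ≤ (U *ᵥ a) ⬝ᵥ G *ᵥ (U *ᵥ a) := by
  rcases eq_or_ne a 0 with rfl | ha0
  · simp
  set b := (vnorm a)⁻¹ • a with hb
  have hb1 : b ⬝ᵥ b = 1 := by rw [← vnorm_sq, vnorm_normalize ha0, one_pow]
  have hb0 : b ≠ 0 := by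
    rintro h
    rw [h] at hb1
    simp at hb1
  have hker : ∃ v, v ≠ 0 ∧ v ᵥ* ((1 - vecMulVec b b) * (Uᵀ * T)) = 0 := by
    refine ⟨b, hb0, ?_⟩
    rw [← vecMul_vecMul, vecMul_sub, vecMul_one, vecMul_vecMulVec, hb1, one_smul, sub_self,
      zero_vecMul]
  obtain ⟨y, hy0, hy⟩ := exists_mulVec_eq_zero_iff.2 (exists_vecMul_eq_zero_iff.1 hker)
  set t := T *ᵥ y with ht
  have ht0 : t ≠ 0 := fun h => hy0 (hinj y h)
  have hUt : Uᵀ *ᵥ t = (b ⬝ᵥ (Uᵀ *ᵥ t)) • b := by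
    rw [← mulVec_mulVec, ← mulVec_mulVec, ← ht, sub_mulVec, one_mulVec, sub_eq_zero,
      vecMulVec_mulVec] at hy
    simpa using hy
  have h1 : ((vnorm t)⁻¹ • t) ⬝ᵥ ((vnorm t)⁻¹ • t) = 1 := by
    rw [← vnorm_sq, vnorm_normalize ht0, one_pow]
  have h2 := hU.le_of_transpose_mulVec hG hb1 h1 (r := (vnorm t)⁻¹ * (b ⬝ᵥ (Uᵀ *ᵥ t)))
    (by rw [mulVec_smul, mul_smul, ← hUt])
  have h3 := hT y
  rw [← ht, ← vnorm_sq] at h3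
  simp only [hb, mulVec_smul, smul_dotProduct, dotProduct_smul, smul_eq_mul] at h2
  have ha' := vnorm_pos ha0
  have ht' := vnorm_pos ht0
  rw [← mul_assoc, ← mul_assoc, ← mul_inv, ← mul_inv, ← sq, ← sq] at h2
  have h4 : lo ≤ (vnorm t ^ 2)⁻¹ * (t ⬝ᵥ G *ᵥ t) := by
    rw [← div_eq_inv_mul, le_div_iff₀ (by positivity)]
    exact h3
  have h5 := h4.trans h2
  rw [← div_eq_inv_mul, le_div_iff₀ (by positivity)] at h5
  rwa [← vnorm_sq]

theorem IsTopEig.upper_bound (hU : IsTopEig G U) (hG : G.IsSymm) {R : Matrix ι κ ℝ} {hi : ℝ}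
    (hR : ∀ w, Rᵀ *ᵥ w = 0 → w ⬝ᵥ G *ᵥ w ≤ hi * (w ⬝ᵥ w)) {w : ι → ℝ} (hw : Uᵀ *ᵥ w = 0) :
    w ⬝ᵥ G *ᵥ w ≤ hi * (w ⬝ᵥ w) := by
  rcases eq_or_ne w 0 with rfl | hw0
  · simp
  have hw2 : 0 < w ⬝ᵥ w := by
    rw [← vnorm_sq]
    have := vnorm_pos hw0
    positivity
  obtain ⟨α, t, hne, hα⟩ : ∃ (α : κ → ℝ) (t : ℝ), 0 < α ⬝ᵥ α + t ^ 2 ∧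
      Rᵀ *ᵥ (U *ᵥ α + t • w) = 0 := by
    by_cases hdet : (Rᵀ * U).det = 0
    · obtain ⟨α, hα0, hα⟩ := exists_mulVec_eq_zero_iff.2 hdet
      refine ⟨α, 0, ?_, ?_⟩
      · rw [← vnorm_sq]
        have := vnorm_pos hα0
        positivity
      · rw [zero_smul, add_zero, mulVec_mulVec, hα]
    · refine ⟨-((Rᵀ * U)⁻¹ *ᵥ (Rᵀ *ᵥ w)), 1, ?_, ?_⟩
      · rw [← vnorm_sq]
        positivity
      · rw [one_smul, mulVec_add, mulVec_mulVec, mulVec_neg, mulVec_mulVec _ (Rᵀ * U),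
          mul_nonsing_inv _ (Ne.isUnit hdet), one_mulVec, neg_add_cancel]
  have h1 := hR _ hα
  have h2 := hU.compl_le hG hw α
  have h3 := hU.dotProduct_eq_zero hG hw α
  have h4 : w ⬝ᵥ (U *ᵥ α) = 0 := by rw [← transpose_mulVec_dotProduct, hw, zero_dotProduct]
  simp only [mulVec_add, mulVec_smul, add_dotProduct, dotProduct_add, smul_dotProduct,
    dotProduct_smul, smul_eq_mul] at h1
  rw [dotProduct_mulVec_comm hG (U *ᵥ α) w, dotProduct_comm (U *ᵥ α) w, h3, h4,
    dotProduct_mulVec_of_transpose_mul_self hU.1] at h1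
  have h5 : (α ⬝ᵥ α + t ^ 2 * (w ⬝ᵥ w)) * (w ⬝ᵥ G *ᵥ w)
      ≤ (α ⬝ᵥ α + t ^ 2 * (w ⬝ᵥ w)) * (hi * (w ⬝ᵥ w)) := by
    nlinarith [mul_le_mul_of_nonneg_left h1 hw2.le]
  refine le_of_mul_le_mul_left h5 ?_
  rcases eq_or_ne t 0 with rfl | ht
  · simpa using hne
  · have : 0 ≤ α ⬝ᵥ α := by rw [← vnorm_sq]; positivity
    positivity

theorem IsTopEig.spectralGap (hU : IsTopEig G U) (hG : G.IsSymm) {T : Matrix ι κ ℝ} {lo hi : ℝ}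
    (hT : ∀ y, lo * ((T *ᵥ y) ⬝ᵥ (T *ᵥ y)) ≤ (T *ᵥ y) ⬝ᵥ G *ᵥ (T *ᵥ y))
    (hinj : ∀ y, T *ᵥ y = 0 → y = 0)
    (hR : ∀ w, Tᵀ *ᵥ w = 0 → w ⬝ᵥ G *ᵥ w ≤ hi * (w ⬝ᵥ w)) :
    SpectralGap G U lo hi :=
  ⟨hU.1, hU.mul_eq hG, hU.lower_bound hG hT hinj, fun _ hw => hU.upper_bound hG hR hw⟩

theorem exists_top_eigenvector [DecidableEq ι] [Nonempty ι] (hG : G.IsSymm) :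
    ∃ v : ι → ℝ, v ⬝ᵥ v = 1 ∧ G *ᵥ v = (v ⬝ᵥ G *ᵥ v) • v ∧
      ∀ z, z ⬝ᵥ G *ᵥ z ≤ (v ⬝ᵥ G *ᵥ v) * (z ⬝ᵥ z) := by
  obtain ⟨i⟩ := ‹Nonempty ι›
  obtain ⟨U, hU⟩ := exists_isTopEig (κ := Unit) G
    ⟨of fun j _ => (Pi.single i 1 : ι → ℝ) j, by ext; simp [Matrix.mul_apply, Pi.single_apply]⟩
  have h1 : (1 : Unit → ℝ) ⬝ᵥ 1 = 1 := by simp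
  have hUv : (U *ᵥ 1) ⬝ᵥ (U *ᵥ (1 : Unit → ℝ)) = 1 := by
    rw [dotProduct_mulVec_of_transpose_mul_self hU.1, h1]
  refine ⟨U *ᵥ 1, hUv, ?_, fun z => ?_⟩
  · have h2 := congrArg (fun M : Matrix ι Unit ℝ => M *ᵥ (1 : Unit → ℝ)) (hU.mul_eq hG)
    simp only [← mulVec_mulVec] at h2
    rw [h2, ← mulVec_smul]
    congr 1
    ext j
    rw [dotProduct_mulVec_of_transpose_mul_self hU.1]
    simp [dotProduct]
  · rcases eq_or_ne z 0 with rfl | hz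
    · simp
    have h2 : ((vnorm z)⁻¹ • z) ⬝ᵥ ((vnorm z)⁻¹ • z) = 1 := by
      rw [← vnorm_sq, vnorm_normalize hz, one_pow]
    have h3 := hU.le_of_transpose_mulVec hG h1 h2 (r := (Uᵀ *ᵥ ((vnorm z)⁻¹ • z)) ())
      (by ext; simp)
    have hz' := vnorm_pos hz
    simp only [mulVec_smul, smul_dotProduct, dotProduct_smul, smul_eq_mul] at h3
    rw [← mul_assoc, ← mul_inv, ← sq, ← div_eq_inv_mul, div_le_iff₀ (by positivity),
      vnorm_sq] at h3
    exact h3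

theorem exists_top_singular_vector [Nonempty κ] (X : Matrix ι κ ℝ) :
    ∃ v : κ → ℝ, v ⬝ᵥ v = 1 ∧ Xᵀ *ᵥ (X *ᵥ v) = ‖X‖ ^ 2 • v := by
  obtain ⟨v, hv1, hv, hmax⟩ := exists_top_eigenvector (G := Xᵀ * X)
    (by rw [IsSymm, transpose_mul, transpose_transpose])
  simp only [← mulVec_mulVec, dotProduct_transpose_mulVec, ← vnorm_sq] at hv hmax hv1
  have hv1' : vnorm v = 1 := (pow_eq_one_iff_of_nonneg (vnorm_nonneg v) two_ne_zero).1 hv1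
  have : ‖X‖ = vnorm (X *ᵥ v) := by
    refine le_antisymm (norm_le_of_vnorm_mulVec_le (vnorm_nonneg _) fun z => ?_) ?_
    · refine le_of_pow_le_pow_left₀ two_ne_zero (mul_nonneg (vnorm_nonneg _) (vnorm_nonneg _)) ?_
      rw [mul_pow]
      exact hmax z
    · simpa [hv1'] using vnorm_mulVec_le X v
  exact ⟨v, by rw [← vnorm_sq, hv1], by rw [this, hv]⟩

theorem sylvester_norm_le [Nonempty κ] {X F : Matrix ι κ ℝ} {H : Matrix κ κ ℝ} {lo hi : ℝ}
    (hF : X * H - G * X = F) (hH : ∀ a, lo * (a ⬝ᵥ a) ≤ a ⬝ᵥ H *ᵥ a)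
    (hG : ∀ v, (X *ᵥ v) ⬝ᵥ G *ᵥ (X *ᵥ v) ≤ hi * ((X *ᵥ v) ⬝ᵥ (X *ᵥ v))) :
    (lo - hi) * ‖X‖ ≤ ‖F‖ := by
  obtain ⟨v, hv1, hv⟩ := exists_top_singular_vector X
  have hv1' : vnorm v = 1 :=
    (pow_eq_one_iff_of_nonneg (vnorm_nonneg v) two_ne_zero).1 (by rw [vnorm_sq, hv1])
  have hXX : (X *ᵥ v) ⬝ᵥ (X *ᵥ v) = ‖X‖ ^ 2 := by
    rw [← dotProduct_transpose_mulVec, hv, dotProduct_smul, hv1, smul_eq_mul, mul_one]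
  have hXH : (X *ᵥ v) ⬝ᵥ ((X * H) *ᵥ v) = ‖X‖ ^ 2 * (v ⬝ᵥ H *ᵥ v) := by
    rw [← mulVec_mulVec, ← transpose_mulVec_dotProduct, hv, smul_dotProduct, smul_eq_mul]
  have h1 : (X *ᵥ v) ⬝ᵥ (F *ᵥ v) ≤ ‖X‖ * ‖F‖ := by
    refine (dotProduct_le_vnorm _ _).trans ?_
    have h1 := vnorm_mulVec_le X v
    have h2 := vnorm_mulVec_le F v
    rw [hv1', mul_one] at h1 h2
    exact mul_le_mul h1 h2 (vnorm_nonneg _) (norm_nonneg _)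
  rw [← hF, sub_mulVec, dotProduct_sub, hXH, ← mulVec_mulVec, hF] at h1
  have h2 := hH v
  have h3 := hG v
  rw [hv1, mul_one] at h2
  rw [hXX] at h3
  rcases (norm_nonneg X).eq_or_lt with h0 | hpos
  · rw [← h0]
    simp
  · refine le_of_mul_le_mul_left ?_ hpos
    nlinarith [mul_le_mul_of_nonneg_left h2 (sq_nonneg ‖X‖)]

theorem SpectralGap.projection_comm {V : Matrix ι κ ℝ} {lo hi : ℝ} (hG : G.IsSymm)
    (hV : SpectralGap G V lo hi) : V * Vᵀ * G = G * (V * Vᵀ) := by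
  have h1 := congrArg transpose hV.invariant
  simp only [transpose_mul, transpose_transpose, hG.eq] at h1
  calc V * Vᵀ * G = V * (Vᵀ * G * V) * Vᵀ := by
        conv_lhs => rw [Matrix.mul_assoc, h1]
        simp only [Matrix.mul_assoc]
    _ = G * (V * Vᵀ) := by rw [← hV.invariant, Matrix.mul_assoc]

theorem SpectralGap.norm_mul_le [Nonempty κ] {κ' : Type*} [Fintype κ'] [DecidableEq κ']
    [DecidableEq ι]
    {V V' : Matrix ι κ ℝ} {lo hi : ℝ} (hG : G.IsSymm) (hV : SpectralGap G V lo hi)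
    (hV' : SpectralGap G V' lo hi) (h : hi < lo) (W : Matrix κ' ι ℝ) : ‖W * V'‖ ≤ ‖W * V‖ := by
  have hcomm := hV.projection_comm hG
  set X := V' - V * Vᵀ * V' with hX
  have hVX : Vᵀ * X = 0 := by
    rw [hX, Matrix.mul_sub, ← Matrix.mul_assoc, ← Matrix.mul_assoc, hV.orthonormal, Matrix.one_mul,
      sub_self]
  have h1 : X * (V'ᵀ * G * V') - G * X = 0 := by
    rw [hX, Matrix.sub_mul, Matrix.mul_assoc (V * Vᵀ), ← hV'.invariant, Matrix.mul_sub,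
      ← Matrix.mul_assoc, hcomm, Matrix.mul_assoc G,
      sub_self]
  have h2 := sylvester_norm_le h1 (lo := lo) (hi := hi) (fun a => ?_) (fun v => ?_)
  · rw [norm_zero] at h2
    have h3 : ‖X‖ = 0 := le_antisymm (by nlinarith [sub_pos.2 h]) (norm_nonneg X)
    rw [norm_eq_zero, hX, sub_eq_zero] at h3
    have h4 : ‖Vᵀ * V'‖ ≤ 1 := by
      refine (l2_opNorm_mul _ _).trans ?_
      rw [norm_transpose]
      exact mul_le_one₀ (norm_le_one_of_transpose_mul_self hV.orthonormal) (norm_nonneg _)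
        (norm_le_one_of_transpose_mul_self hV'.orthonormal)
    calc ‖W * V'‖ = ‖W * V * (Vᵀ * V')‖ := by
          conv_lhs => rw [h3]
          simp only [Matrix.mul_assoc]
      _ ≤ ‖W * V‖ * ‖Vᵀ * V'‖ := l2_opNorm_mul _ _
      _ ≤ ‖W * V‖ := mul_le_of_le_one_right (norm_nonneg _) h4
  · rw [← mulVec_mulVec, ← mulVec_mulVec, dotProduct_transpose_mulVec]
    exact hV'.lower a
  · exact hV.upper _ (by rw [mulVec_mulVec, hVX, zero_mulVec])

end SpectralGap

section Polar

open scoped Matrix.Norms.L2Operator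

variable {d : ℕ}

theorem frob_sq (X : Matrix (Fin d) (Fin d) ℝ) : frob X ^ 2 = trace (Xᵀ * X) := by
  rw [frob, Real.sq_sqrt (by positivity), Finset.sum_comm]
  simp [trace, mul_apply, sq]

theorem IsOrth.mul {Q R : Matrix (Fin d) (Fin d) ℝ} (hQ : IsOrth Q) (hR : IsOrth R) :
    IsOrth (Q * R) := by
  constructor
  · rw [transpose_mul, Matrix.mul_assoc, ← Matrix.mul_assoc Qᵀ, hQ.1, Matrix.one_mul, hR.1]
  · rw [transpose_mul, Matrix.mul_assoc, ← Matrix.mul_assoc R, hR.2, Matrix.one_mul, hQ.2]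

theorem IsOrth.transpose {Q : Matrix (Fin d) (Fin d) ℝ} (hQ : IsOrth Q) : IsOrth Qᵀ :=
  ⟨by rw [transpose_transpose, hQ.2], by rw [transpose_transpose, hQ.1]⟩

theorem isOrth_reflection {a : Fin d → ℝ} (ha : a ⬝ᵥ a = 1) :
    IsOrth (1 - (2 : ℝ) • vecMulVec a a) := by
  have : (1 - (2 : ℝ) • vecMulVec a a) * (1 - (2 : ℝ) • vecMulVec a a) = 1 := by
    simp only [Matrix.mul_sub, Matrix.sub_mul, Matrix.one_mul, Matrix.mul_one, Matrix.smul_mul,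
      Matrix.mul_smul, vecMulVec_mul_vecMulVec, ha, one_smul]
    module
  have htr : (1 - (2 : ℝ) • vecMulVec a a)ᵀ = 1 - (2 : ℝ) • vecMulVec a a := by
    rw [transpose_sub, transpose_smul, transpose_vecMulVec, transpose_one]
  exact ⟨by rw [htr, this], by rw [htr, this]⟩

theorem IsOrth.frob_sub_sq {T : Matrix (Fin d) (Fin d) ℝ} (hT : IsOrth T)
    (X : Matrix (Fin d) (Fin d) ℝ) :
    frob (X - T) ^ 2 =
      trace (Xᵀ * X) - 2 * trace (Tᵀ * X) + trace (1 : Matrix (Fin d) (Fin d) ℝ) := by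
  rw [frob_sq, transpose_sub, Matrix.sub_mul, Matrix.mul_sub, Matrix.mul_sub, hT.1]
  simp only [trace_sub]
  rw [← trace_transpose (Xᵀ * T), transpose_mul, transpose_transpose]
  ring

theorem IsPolar.trace_le {X R Q : Matrix (Fin d) (Fin d) ℝ} (h : IsPolar X R) (hQ : IsOrth Q) :
    trace (Qᵀ * X) ≤ trace (Rᵀ * X) := by
  have h1 : frob (X - R) ^ 2 ≤ frob (X - Q) ^ 2 :=
    pow_le_pow_left₀ (Real.sqrt_nonneg _) (h.2 Q hQ) 2
  rw [h.1.frob_sub_sq, hQ.frob_sub_sq] at h1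
  linarith

theorem isPolar_of_trace_le {X R : Matrix (Fin d) (Fin d) ℝ} (hR : IsOrth R)
    (h : ∀ Q, IsOrth Q → trace (Qᵀ * X) ≤ trace (Rᵀ * X)) : IsPolar X R := by
  refine ⟨hR, fun Q hQ => ?_⟩
  refine le_of_pow_le_pow_left₀ two_ne_zero (Real.sqrt_nonneg _) ?_
  rw [hR.frob_sub_sq, hQ.frob_sub_sq]
  linarith [h Q hQ]

theorem exists_isPolar (X : Matrix (Fin d) (Fin d) ℝ) : ∃ R, IsPolar X R := by
  obtain ⟨R, hR, hmin⟩ := (isCompact_stiefel (ι := Fin d) (κ := Fin d)).exists_isMinOn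
    ⟨1, by simp⟩ (f := fun Q => frob (X - Q)) (by unfold frob; fun_prop)
  exact ⟨R, ⟨hR, mul_eq_one_comm.1 hR⟩, fun Q hQ => hmin hQ.1⟩

theorem IsPolar.mul_left {X R Q : Matrix (Fin d) (Fin d) ℝ} (h : IsPolar X R) (hQ : IsOrth Q) :
    IsPolar (Q * X) (Q * R) := by
  refine isPolar_of_trace_le (hQ.mul h.1) fun T hT => ?_
  have h1 := h.trace_le (hQ.transpose.mul hT)
  rw [transpose_mul, transpose_transpose, Matrix.mul_assoc] at h1
  rwa [transpose_mul, Matrix.mul_assoc, ← Matrix.mul_assoc Qᵀ, hQ.1, Matrix.one_mul]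

theorem IsPolar.quadratic_nonneg {X R : Matrix (Fin d) (Fin d) ℝ} (h : IsPolar X R)
    (a : Fin d → ℝ) : 0 ≤ a ⬝ᵥ (Rᵀ * X) *ᵥ a := by
  rcases eq_or_ne a 0 with rfl | ha
  · simp
  have h1 : ((vnorm a)⁻¹ • a) ⬝ᵥ ((vnorm a)⁻¹ • a) = 1 := by
    rw [← vnorm_sq, vnorm_normalize ha, one_pow]
  have h2 := h.trace_le (h.1.mul (isOrth_reflection h1))
  rw [transpose_mul, Matrix.mul_assoc, transpose_sub, transpose_smul, transpose_vecMulVec,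
    transpose_one, Matrix.sub_mul, Matrix.one_mul, trace_sub, Matrix.smul_mul, trace_smul,
    vecMulVec_mul, trace_vecMulVec, dotProduct_comm, ← dotProduct_mulVec] at h2
  have h3 : 0 ≤ ((vnorm a)⁻¹ • a) ⬝ᵥ (Rᵀ * X) *ᵥ ((vnorm a)⁻¹ • a) := by
    simp only [smul_eq_mul] at h2
    linarith
  simp only [mulVec_smul, smul_dotProduct, dotProduct_smul, smul_eq_mul] at h3
  have ha' := inv_pos.2 (vnorm_pos ha)
  exact nonneg_of_mul_nonneg_right (nonneg_of_mul_nonneg_right h3 ha') ha'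

theorem IsPolar.isSymm {X R : Matrix (Fin d) (Fin d) ℝ} (h : IsPolar X R) : (Rᵀ * X).IsSymm := by
  set H := Rᵀ * X with hH
  ext i j
  rw [transpose_apply]
  rcases eq_or_ne i j with rfl | hij
  · rfl
  have key : 2 * (H i j - H j i) = 0 := by
    refine eq_zero_of_forall_circle (p := -2 * (H i i + H j j)) fun c s hcs => ?_
    set a : Fin d → ℝ := Pi.single i 1 with ha
    set e : Fin d → ℝ := Pi.single j 1 with he
    have haa : a ⬝ᵥ a = 1 := by simp [ha]
    have hee : e ⬝ᵥ e = 1 := by simp [he]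
    have hae : a ⬝ᵥ e = 0 := by simp [ha, he, hij]
    have hea : e ⬝ᵥ a = 0 := by rw [dotProduct_comm, hae]
    have hbb : (c • a + s • e) ⬝ᵥ (c • a + s • e) = 1 := by
      simp only [add_dotProduct, dotProduct_add, smul_dotProduct, dotProduct_smul, smul_eq_mul,
        haa, hee, hae, hea]
      linear_combination hcs
    have hba : (c • a + s • e) ⬝ᵥ a = c := by
      simp only [add_dotProduct, smul_dotProduct, smul_eq_mul, haa, hea]
      ring
    have h2 := h.trace_le (h.1.mul ((isOrth_reflection haa).mul (isOrth_reflection hbb)))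
    rw [transpose_mul, Matrix.mul_assoc, ← hH] at h2
    simp only [transpose_mul, transpose_sub, transpose_smul, transpose_vecMulVec,
      transpose_one] at h2
    simp only [Matrix.sub_mul, Matrix.mul_sub, Matrix.one_mul, Matrix.mul_one, Matrix.smul_mul,
      Matrix.mul_smul, vecMulVec_mul, trace_sub, trace_smul, trace_vecMulVec, smul_eq_mul,
      dotProduct_comm _ (_ ᵥ* H), ← dotProduct_mulVec] at h2
    simp only [vecMulVec_mulVec, hba, mulVec_add, mulVec_smul, add_dotProduct,
      dotProduct_add, smul_dotProduct, dotProduct_smul, smul_eq_mul, op_smul_eq_smul] at h2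
    have hent : ∀ k l : Fin d, (Pi.single k 1 : Fin d → ℝ) ⬝ᵥ H *ᵥ Pi.single l 1 = H k l := by
      simp
    simp only [ha, he, hent] at h2
    linear_combination h2 - 2 * H i i * hcs
  linarith

theorem le_quadratic_of_le_vnorm {K : Matrix (Fin d) (Fin d) ℝ} [NeZero d] (hK : K.IsSymm)
    (hpos : ∀ a, 0 ≤ a ⬝ᵥ K *ᵥ a) {k : ℝ} (hk : ∀ a, k * vnorm a ≤ vnorm (K *ᵥ a))
    (a : Fin d → ℝ) : k * (a ⬝ᵥ a) ≤ a ⬝ᵥ K *ᵥ a := by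
  obtain ⟨v, hv1, hv, hmax⟩ := exists_top_eigenvector (G := -K)
    (by rw [IsSymm, transpose_neg, hK.eq])
  simp only [neg_mulVec, dotProduct_neg] at hv hmax
  have hv1' : vnorm v = 1 :=
    (pow_eq_one_iff_of_nonneg (vnorm_nonneg v) two_ne_zero).1 (by rw [vnorm_sq, hv1])
  have h1 := hk v
  rw [neg_smul, neg_inj] at hv
  rw [hv, vnorm_smul, hv1', mul_one, mul_one, abs_of_nonneg (hpos v)] at h1
  have h2 : 0 ≤ a ⬝ᵥ a := by rw [← vnorm_sq]; positivity
  nlinarith [hmax a]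

theorem IsOrth.vnorm_mulVec {Q : Matrix (Fin d) (Fin d) ℝ} (hQ : IsOrth Q) (v : Fin d → ℝ) :
    vnorm (Q *ᵥ v) = vnorm v := by
  rw [← sq_eq_sq₀ (vnorm_nonneg _) (vnorm_nonneg _), vnorm_sq, vnorm_sq,
    dotProduct_mulVec_of_transpose_mul_self hQ.1]

theorem IsPolar.norm_sub_le [NeZero d] {X Y R Q : Matrix (Fin d) (Fin d) ℝ} (hX : IsPolar X R)
    (hY : IsPolar Y Q) {k : ℝ} (hk : ∀ v, k * vnorm v ≤ vnorm (Y *ᵥ v)) :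
    k * ‖R - Q‖ ≤ 2 * ‖X - Y‖ := by
  set H := Rᵀ * X with hH
  set K := Qᵀ * Y with hK
  set T := Qᵀ * R with hT
  set E := Qᵀ * (X - Y) with hE
  have hQn : ‖Qᵀ‖ ≤ 1 := norm_le_one_of_transpose_mul_self hY.1.transpose.1
  have hTT : T * Tᵀ = 1 := (hY.1.transpose.mul hX.1).2
  have hTn : ‖T‖ ≤ 1 := norm_le_one_of_transpose_mul_self (hY.1.transpose.mul hX.1).1
  have hTH : T * H = Qᵀ * X := by
    rw [hT, hH, Matrix.mul_assoc, ← Matrix.mul_assoc R, hX.1.2, Matrix.one_mul]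
  have hE1 : E = T * H - K := by rw [hE, hTH, Matrix.mul_sub]
  have hE2 : Eᵀ * T = H - K * T := by
    rw [hE1, transpose_sub, transpose_mul, hX.isSymm.eq, hY.isSymm.eq, Matrix.sub_mul,
      Matrix.mul_assoc, mul_eq_one_comm.1 hTT, Matrix.mul_one]
  have hF : (T - 1) * H - (-K) * (T - 1) = E - Eᵀ * T := by
    rw [hE2, hE1]
    noncomm_ring
  have hKk : ∀ a, k * vnorm a ≤ vnorm (K *ᵥ a) := by
    intro a
    rw [hK, ← mulVec_mulVec, hY.1.transpose.vnorm_mulVec]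
    exact hk a
  have h1 := sylvester_norm_le hF (lo := 0) (hi := -k)
    (fun a => by rw [zero_mul]; exact hX.quadratic_nonneg a)
    (fun v => by
      rw [neg_mulVec, dotProduct_neg, neg_mul]
      exact neg_le_neg (le_quadratic_of_le_vnorm hY.isSymm hY.quadratic_nonneg hKk _))
  have hEn : ‖E‖ ≤ ‖X - Y‖ :=
    (l2_opNorm_mul _ _).trans (mul_le_of_le_one_left (norm_nonneg _) hQn)
  have hETn : ‖Eᵀ * T‖ ≤ ‖X - Y‖ := by
    refine (l2_opNorm_mul _ _).trans ?_
    rw [norm_transpose]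
    exact (mul_le_of_le_one_right (norm_nonneg _) hTn).trans hEn
  have h2 : ‖R - Q‖ ≤ ‖T - 1‖ := by
    have : R - Q = Q * (T - 1) := by
      rw [hT, Matrix.mul_sub, ← Matrix.mul_assoc, hY.1.2, Matrix.one_mul, Matrix.mul_one]
    rw [this]
    refine (l2_opNorm_mul _ _).trans (mul_le_of_le_one_left (norm_nonneg _) ?_)
    exact norm_le_one_of_transpose_mul_self hY.1.1
  have h3 := _root_.norm_sub_le E (Eᵀ * T)
  rcases le_total k 0 with hk0 | hk0
  · exact (mul_nonpos_of_nonpos_of_nonneg hk0 (norm_nonneg _)).trans (by positivity)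
  · nlinarith [mul_le_mul_of_nonneg_left h2 hk0]

end Polar

section GaussianTail

variable {ι κ : Type*} [Fintype ι] [Fintype κ]

instance : IsProbabilityMeasure (stdGaussian ι κ) := by
  unfold stdGaussian
  infer_instance

theorem integral_exp_mul_gaussianReal (c : ℝ) :
    ∫ x, Real.exp (c * x) ∂(ProbabilityTheory.gaussianReal 0 1) = Real.exp (c ^ 2 / 2) := by
  have h := congrFun (ProbabilityTheory.mgf_id_gaussianReal (μ := 0) (v := 1)) c
  simpa [ProbabilityTheory.mgf] using h

theorem integral_exp_stdGaussian (C : ι → κ → ℝ) :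
    ∫ W, Real.exp (∑ p, ∑ q, C p q * W p q) ∂(stdGaussian ι κ) =
      Real.exp (∑ p, ∑ q, C p q ^ 2 / 2) := by
  simp_rw [Real.exp_sum]
  rw [stdGaussian,
    integral_fintype_prod_eq_prod (fun p (w : κ → ℝ) => ∏ q, Real.exp (C p q * w q))]
  refine Finset.prod_congr rfl fun p _ => ?_
  rw [integral_fintype_prod_eq_prod (fun q (x : ℝ) => Real.exp (C p q * x))]
  exact Finset.prod_congr rfl fun q _ => integral_exp_mul_gaussianReal _

theorem stdGaussian_linear_tail (C : ι → κ → ℝ) (hC : ∑ p, ∑ q, C p q ^ 2 ≤ 1) {t : ℝ}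
    (ht : 0 ≤ t) :
    stdGaussian ι κ {W | t ≤ ∑ p, ∑ q, C p q * W p q} ≤
      ENNReal.ofReal (Real.exp (-(t ^ 2 / 2))) := by
  have hint := integral_exp_stdGaussian (fun p q => t * C p q)
  simp only [mul_assoc, ← Finset.mul_sum] at hint
  have h := ProbabilityTheory.measure_ge_le_exp_mul_mgf (μ := stdGaussian ι κ)
    (X := fun W => ∑ p, ∑ q, C p q * W p q) t ht
    (not_imp_comm.1 integral_undef (by rw [hint]; exact (Real.exp_pos _).ne'))
  rw [ProbabilityTheory.mgf, hint, ← Real.exp_add] at h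
  rw [← ofReal_measureReal]
  refine ENNReal.ofReal_le_ofReal (h.trans (Real.exp_le_exp.2 ?_))
  have : ∑ p, ∑ q, (t * C p q) ^ 2 / 2 = t ^ 2 / 2 * ∑ p, ∑ q, C p q ^ 2 := by
    simp only [Finset.mul_sum]
    exact Finset.sum_congr rfl fun p _ => Finset.sum_congr rfl fun q _ => by ring
  rw [this]
  nlinarith [sq_nonneg t]

end GaussianTail

section Net

theorem exists_half_net (κ : Type*) [Fintype κ] :
    ∃ N : Finset (κ → ℝ), N.card ≤ 5 ^ Fintype.card κ ∧ (∀ v ∈ N, vnorm v ≤ 1) ∧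
      ∀ v, vnorm v ≤ 1 → ∃ w ∈ N, vnorm (v - w) ≤ 1 / 2 := by
  classical
  have hcard : ∀ s : Finset (κ → ℝ), (∀ v ∈ s, vnorm v ≤ 1) →
      (∀ v ∈ s, ∀ w ∈ s, v ≠ w → 1 / 2 < vnorm (v - w)) → s.card ≤ 5 ^ Fintype.card κ := by
    intro s hs hsep
    let f : (κ → ℝ) → EuclideanSpace ℝ κ := fun v => WithLp.toLp 2 ((2 : ℝ) • v)
    have hf : ∀ v w, f v - f w = f (v - w) := fun v w => by
      simp [f, smul_sub]
    have hfn : ∀ v, ‖f v‖ = 2 * vnorm v := fun v => by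
      rw [← vnorm_eq_norm, vnorm_smul, abs_of_pos two_pos]
    have hfi : Function.Injective f := fun v w h => by
      simpa [f] using h
    have h := Besicovitch.card_le_of_separated (s.image f)
      (by
        intro c hc
        obtain ⟨v, hv, rfl⟩ := Finset.mem_image.1 hc
        rw [hfn]
        linarith [hs v hv])
      (by
        intro c hc e he hce
        obtain ⟨v, hv, rfl⟩ := Finset.mem_image.1 hc
        obtain ⟨w, hw, rfl⟩ := Finset.mem_image.1 he
        rw [hf, hfn]
        linarith [hsep v hv w hw fun h => hce (h ▸ rfl)])
    rwa [Finset.card_image_of_injective _ hfi, finrank_euclideanSpace] at h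
  let P : Finset (κ → ℝ) → Prop := fun s => (∀ v ∈ s, vnorm v ≤ 1) ∧
      ∀ v ∈ s, ∀ w ∈ s, v ≠ w → 1 / 2 < vnorm (v - w)
  let K : ℕ → Prop := fun k => ∃ s, P s ∧ s.card = k
  have hK0 : K 0 := ⟨∅, by simp [P], rfl⟩
  obtain ⟨N, hN, hNc⟩ := Nat.findGreatest_spec (P := K) (Nat.zero_le (5 ^ Fintype.card κ)) hK0
  refine ⟨N, hcard N hN.1 hN.2, hN.1, fun v hv => ?_⟩
  by_contra! hcon
  have hvN : v ∉ N := fun h => by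
    have := hcon v h
    rw [sub_self, (vnorm_eq_zero).2 rfl] at this
    norm_num at this
  have hPi : P (insert v N) := by
    refine ⟨fun w hw => ?_, fun u hu w hw huw => ?_⟩
    · rcases Finset.mem_insert.1 hw with rfl | hw
      exacts [hv, hN.1 w hw]
    · rcases Finset.mem_insert.1 hu with rfl | hu <;> rcases Finset.mem_insert.1 hw with rfl | hw
      · exact absurd rfl huw
      · exact hcon w hw
      · have : u - w = (-1 : ℝ) • (w - u) := by module
        rw [this, vnorm_smul, abs_neg, abs_one, one_mul]
        exact hcon u ‹u ∈ N›
      · exact hN.2 u hu w hw huw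
  have hle := Nat.le_findGreatest (P := K) (hcard _ hPi.1 hPi.2) ⟨_, hPi, rfl⟩
  rw [Finset.card_insert_of_notMem hvN, hNc] at hle
  omega

end Net

section NormTail

open scoped Matrix.Norms.L2Operator

variable {ι κ μ : Type*} [Fintype ι] [Fintype κ] [Fintype μ]

theorem vnorm_le_two_mul_of_net {N : Finset (ι → ℝ)}
    (hN : ∀ v, vnorm v ≤ 1 → ∃ w ∈ N, vnorm (v - w) ≤ 1 / 2) {y : ι → ℝ} {t : ℝ}
    (ht : ∀ v ∈ N, v ⬝ᵥ y ≤ t) : vnorm y ≤ 2 * t := by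
  have hv : vnorm ((vnorm y)⁻¹ • y) ≤ 1 := by
    rw [vnorm_smul, abs_of_nonneg (inv_nonneg.2 (vnorm_nonneg y))]
    exact inv_mul_le_one
  obtain ⟨w, hw, hvw⟩ := hN _ hv
  have h1 : vnorm y = ((vnorm y)⁻¹ • y - w) ⬝ᵥ y + w ⬝ᵥ y := by
    rw [sub_dotProduct, sub_add_cancel, smul_dotProduct, ← vnorm_sq, smul_eq_mul]
    rcases eq_or_ne (vnorm y) 0 with h | h
    · simp [h]
    · field_simp
  have h2 := dotProduct_le_vnorm ((vnorm y)⁻¹ • y - w) y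
  have h3 := mul_le_mul_of_nonneg_right hvw (vnorm_nonneg y)
  linarith [ht w hw]

theorem norm_le_four_mul_of_net [DecidableEq μ] {N : Finset (ι → ℝ)} {N' : Finset (μ → ℝ)}
    (hN : ∀ v, vnorm v ≤ 1 → ∃ w ∈ N, vnorm (v - w) ≤ 1 / 2)
    (hN' : ∀ v, vnorm v ≤ 1 → ∃ w ∈ N', vnorm (v - w) ≤ 1 / 2)
    (X : Matrix ι μ ℝ) {t : ℝ} (ht : ∀ v ∈ N, ∀ u ∈ N', v ⬝ᵥ X *ᵥ u ≤ t) : ‖X‖ ≤ 4 * t := by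
  have h1 : ∀ u, vnorm u ≤ 1 → vnorm (X *ᵥ u) ≤ ‖X‖ / 2 + 2 * t := by
    intro u hu
    obtain ⟨w, hw, huw⟩ := hN' u hu
    have h2 := vnorm_le_two_mul_of_net hN fun v hv => ht v hv w hw
    have h3 := vnorm_add_le (X *ᵥ (u - w)) (X *ᵥ w)
    rw [← mulVec_add, sub_add_cancel] at h3
    have h4 := (vnorm_mulVec_le X (u - w)).trans
      (mul_le_mul_of_nonneg_left huw (norm_nonneg X))
    linarith
  have h0 : 0 ≤ ‖X‖ / 2 + 2 * t := (vnorm_nonneg _).trans (h1 0 (by simp [vnorm_eq_norm]))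
  have h : ‖X‖ ≤ ‖X‖ / 2 + 2 * t := by
    refine norm_le_of_vnorm_mulVec_le h0 fun v => ?_
    rcases eq_or_ne v 0 with rfl | hv
    · simp [vnorm_eq_norm]
    have h2 := h1 _ (vnorm_normalize hv).le
    rw [mulVec_smul, vnorm_smul, abs_of_nonneg (inv_nonneg.2 (vnorm_nonneg v)),
      inv_mul_le_iff₀ (vnorm_pos hv)] at h2
    linarith
  linarith

theorem stdGaussian_norm_tail [DecidableEq κ] [DecidableEq μ] {V : Matrix κ μ ℝ} (hV : ‖V‖ ≤ 1)
    {t : ℝ} (ht : 0 ≤ t) :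
    stdGaussian ι κ {W | 4 * t < ‖(Matrix.of W : Matrix ι κ ℝ) * V‖} ≤
      ENNReal.ofReal (5 ^ (Fintype.card ι + Fintype.card μ) * Real.exp (-(t ^ 2 / 2))) := by
  obtain ⟨N, hNc, hN1, hN⟩ := exists_half_net ι
  obtain ⟨N', hNc', hN1', hN'⟩ := exists_half_net μ
  have hsub : {W : ι → κ → ℝ | 4 * t < ‖(Matrix.of W : Matrix ι κ ℝ) * V‖} ⊆
      ⋃ z ∈ N ×ˢ N', {W : ι → κ → ℝ | t ≤ ∑ p, ∑ q, z.1 p * (V *ᵥ z.2) q * W p q} := by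
    intro W hW
    by_contra hcon
    simp only [Set.mem_iUnion, not_exists, Set.mem_ofPred_eq, not_le] at hcon hW
    refine hW.not_ge (norm_le_four_mul_of_net hN hN' _ fun v hv u hu => ?_)
    refine le_of_eq_of_le ?_ (hcon (v, u) (Finset.mk_mem_product hv hu)).le
    rw [← mulVec_mulVec]
    simp only [dotProduct, mulVec, Finset.mul_sum, of_apply]
    exact Finset.sum_congr rfl fun p _ => Finset.sum_congr rfl fun q _ => by
      simp only [Finset.sum_mul]
      exact Finset.sum_congr rfl fun r _ => by ring
  have hterm : ∀ z ∈ N ×ˢ N',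
      stdGaussian ι κ {W | t ≤ ∑ p, ∑ q, z.1 p * (V *ᵥ z.2) q * W p q} ≤
        ENNReal.ofReal (Real.exp (-(t ^ 2 / 2))) := by
    intro z hz
    obtain ⟨hz1, hz2⟩ := Finset.mem_product.1 hz
    refine stdGaussian_linear_tail (fun p q => z.1 p * (V *ᵥ z.2) q) ?_ ht
    have h1 : ∑ p, ∑ q, (z.1 p * (V *ᵥ z.2) q) ^ 2 = vnorm z.1 ^ 2 * vnorm (V *ᵥ z.2) ^ 2 := by
      rw [vnorm_sq, vnorm_sq, dotProduct, dotProduct, Finset.sum_mul_sum]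
      exact Finset.sum_congr rfl fun p _ => Finset.sum_congr rfl fun q _ => by ring
    rw [h1, ← mul_pow]
    refine pow_le_one₀ (mul_nonneg (vnorm_nonneg _) (vnorm_nonneg _)) ?_
    refine mul_le_one₀ (hN1 _ hz1) (vnorm_nonneg _) ((vnorm_mulVec_le V z.2).trans ?_)
    exact mul_le_one₀ hV (vnorm_nonneg _) (hN1' _ hz2)
  refine (measure_mono hsub).trans ((measure_biUnion_finset_le _ _).trans ?_)
  refine (Finset.sum_le_card_nsmul _ _ _ hterm).trans ?_
  rw [Finset.card_product, nsmul_eq_mul, ENNReal.ofReal_mul (by positivity), pow_add]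
  refine mul_le_mul_left ?_ _
  rw [ENNReal.ofReal_mul (by positivity), ENNReal.ofReal_pow (by norm_num),
    ENNReal.ofReal_pow (by norm_num), Nat.cast_mul]
  simp only [ENNReal.ofReal_ofNat]
  exact mul_le_mul' (by exact_mod_cast hNc) (by exact_mod_cast hNc')

end NormTail

section Fibre

variable {ι κ : Type*} [Fintype ι] [Fintype κ]

theorem stdGaussian_le_of_fibre (p : ι → Prop) [DecidablePred p] {B : Set (ι → κ → ℝ)}
    (hB : MeasurableSet B) {ε : ENNReal}
    (h : ∀ W₀ : {x // ¬p x} → κ → ℝ, stdGaussian {x // p x} κ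
      {W | (fun x => if hx : p x then W ⟨x, hx⟩ else W₀ ⟨x, hx⟩) ∈ B} ≤ ε) :
    stdGaussian ι κ B ≤ ε := by
  have hmp := measurePreserving_piEquivPiSubtypeProd
    (fun _ : ι => Measure.pi fun _ : κ => ProbabilityTheory.gaussianReal 0 1) p
  set e := MeasurableEquiv.piEquivPiSubtypeProd (fun _ : ι => κ → ℝ) p
  have h1 := hmp.symm.measure_preimage hB.nullMeasurableSet
  rw [stdGaussian, ← h1, Measure.prod_apply_symm (e.symm.measurable hB)]
  refine (lintegral_mono h).trans ?_
  rw [lintegral_const, measure_univ, mul_one]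

end Fibre

section LeaveOneOut

open scoped Matrix.Norms.L2Operator

variable {ι κ μ : Type*} [Fintype κ] [Fintype μ] [DecidableEq μ]

theorem spectralGap_iff {G : Matrix κ κ ℝ} {V : Matrix κ μ ℝ} {lo hi : ℝ} :
    SpectralGap G V lo hi ↔ Vᵀ * V = 1 ∧ G * V = V * (Vᵀ * G * V) ∧
      (∀ a, lo * (a ⬝ᵥ a) ≤ (V *ᵥ a) ⬝ᵥ G *ᵥ (V *ᵥ a)) ∧
      ∀ w, (w - V *ᵥ (Vᵀ *ᵥ w)) ⬝ᵥ G *ᵥ (w - V *ᵥ (Vᵀ *ᵥ w)) ≤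
        hi * ((w - V *ᵥ (Vᵀ *ᵥ w)) ⬝ᵥ (w - V *ᵥ (Vᵀ *ᵥ w))) := by
  refine ⟨fun h => ⟨h.orthonormal, h.invariant, h.lower, fun w => h.upper _ ?_⟩,
    fun ⟨h1, h2, h3, h4⟩ => ⟨h1, h2, h3, fun w hw => ?_⟩⟩
  · rw [mulVec_sub, mulVec_mulVec, mulVec_mulVec, h.orthonormal,
      Matrix.one_mul, sub_self]
  · simpa [hw] using h4 w

theorem isClosed_spectralGap (lo hi : ℝ) :
    IsClosed {z : Matrix κ κ ℝ × Matrix κ μ ℝ | SpectralGap z.1 z.2 lo hi} := by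
  simp only [spectralGap_iff, Set.ofPred_and, Set.ofPred_forall]
  refine IsClosed.inter ?_ (IsClosed.inter ?_ (IsClosed.inter ?_ ?_))
  · exact isClosed_eq (by fun_prop) continuous_const
  · exact isClosed_eq (by fun_prop) (by fun_prop)
  · exact isClosed_iInter fun a => isClosed_le (by fun_prop) (by fun_prop)
  · exact isClosed_iInter fun w => isClosed_le (by fun_prop) (by fun_prop)

theorem isClosed_exists_spectralGap {M : (ι → κ → ℝ) → Matrix κ κ ℝ} (hM : Continuous M)
    {f : (ι → κ → ℝ) → Matrix κ μ ℝ → ℝ}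
    (hf : Continuous fun z : (ι → κ → ℝ) × Matrix κ μ ℝ => f z.1 z.2)
    (lo hi t : ℝ) :
    IsClosed {W | ∃ V : Matrix κ μ ℝ, SpectralGap (M W) V lo hi ∧ t ≤ f W V} := by
  have hK : CompactSpace {V : Matrix κ μ ℝ | Vᵀ * V = 1} :=
    isCompact_iff_compactSpace.1 isCompact_stiefel
  have hT : IsClosed {z : (ι → κ → ℝ) × {V : Matrix κ μ ℝ | Vᵀ * V = 1} |
      SpectralGap (M z.1) z.2.1 lo hi ∧ t ≤ f z.1 z.2.1} := by
    refine IsClosed.inter ?_ ?_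
    · exact (isClosed_spectralGap lo hi).preimage
        (f := fun z : (ι → κ → ℝ) × {V : Matrix κ μ ℝ | Vᵀ * V = 1} => (M z.1, z.2.1))
        (by fun_prop)
    · exact isClosed_le continuous_const
        (hf.comp (continuous_fst.prodMk (continuous_subtype_val.comp continuous_snd)))
  convert isClosedMap_fst_of_compactSpace _ hT using 1
  ext W
  constructor
  · rintro ⟨V, hV, ht⟩
    exact ⟨(W, ⟨V, hV.orthonormal⟩), ⟨hV, ht⟩, rfl⟩
  · rintro ⟨⟨W', V⟩, ⟨hV, ht⟩, rfl⟩
    exact ⟨V.1, hV, ht⟩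

/-- If the Gram-type matrix `M W` does not depend on the rows of `W` selected by `p`, then those
rows are unlikely to correlate with the top invariant subspace of `M W`. -/
theorem stdGaussian_leave_out [Fintype ι] [DecidableEq κ] [Nonempty μ]
    (p : ι → Prop) [DecidablePred p]
    {M : (ι → κ → ℝ) → Matrix κ κ ℝ} (hM : Continuous M) (hsymm : ∀ W, (M W).IsSymm)
    (hloc : ∀ W W', (∀ x, ¬p x → W x = W' x) → M W = M W') {lo hi : ℝ} (hlt : hi < lo)
    {t : ℝ} (ht : 0 < t) :
    stdGaussian ι κ {W | ∃ V : Matrix κ μ ℝ, SpectralGap (M W) V lo hi ∧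
        5 * t ≤ ‖(Matrix.of fun x : {x // p x} => W x) * V‖} ≤
      ENNReal.ofReal (5 ^ (Fintype.card {x // p x} + Fintype.card μ) *
        Real.exp (-(t ^ 2 / 2))) := by
  refine stdGaussian_le_of_fibre p ?_ fun W₀ => ?_
  · exact (isClosed_exists_spectralGap hM (by fun_prop) lo hi (5 * t)).measurableSet
  · by_cases hV : ∃ V : Matrix κ μ ℝ, SpectralGap
        (M fun x => if hx : p x then 0 else W₀ ⟨x, hx⟩) V lo hi
    · obtain ⟨V, hV⟩ := hV
      refine (measure_mono ?_).trans
        (stdGaussian_norm_tail (norm_le_one_of_transpose_mul_self hV.orthonormal) ht.le)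
      rintro W ⟨V', hV', hle⟩
      rw [hloc _ (fun x => if hx : p x then 0 else W₀ ⟨x, hx⟩)
        (fun x hx => by simp [hx])] at hV'
      classical
      have h1 := hV.norm_mul_le (hsymm _) hV' hlt (Matrix.of W)
      have h2 : (Matrix.of fun x : {x // p x} => if hx : p x then W ⟨x, hx⟩ else W₀ ⟨x, hx⟩) =
        Matrix.of W := by
        ext x y
        simp [x.2]
      rw [h2] at hle
      exact (lt_of_lt_of_le (by linarith) hle).trans_le h1
    · refine le_of_eq_of_le (measure_mono_null ?_ measure_empty) zero_le
      rintro W ⟨V', hV', -⟩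
      rw [hloc _ (fun x => if hx : p x then 0 else W₀ ⟨x, hx⟩)
        (fun x hx => by simp [hx])] at hV'
      exact hV ⟨V', hV'⟩

end LeaveOneOut

section Blocks

open scoped Matrix.Norms.L2Operator

variable {n d k l : ℕ}

theorem blk_mul (X : Matrix (Fin n × Fin d) (Fin k) ℝ) (Y : Matrix (Fin k) (Fin l) ℝ)
    (i : Fin n) : blk (X * Y) i = blk X i * Y := rfl

theorem blk_add (X Y : Matrix (Fin n × Fin d) (Fin k) ℝ) (i : Fin n) :
    blk (X + Y) i = blk X i + blk Y i := rfl

theorem blk_smul (c : ℝ) (X : Matrix (Fin n × Fin d) (Fin k) ℝ) (i : Fin n) :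
    blk (c • X) i = c • blk X i := rfl

theorem blk_stack (B : Fin n → Matrix (Fin d) (Fin k) ℝ) (i : Fin n) : blk (stack B) i = B i := rfl

theorem blk_mask (X : Matrix (Fin n × Fin d) (Fin k) ℝ) (i j : Fin n) :
    blk (mask X i) j = if j = i then 0 else blk X j := by
  ext a b
  by_cases h : j = i <;> simp [blk, mask, h]

theorem mask_add (X Y : Matrix (Fin n × Fin d) (Fin k) ℝ) (i : Fin n) :
    mask (X + Y) i = mask X i + mask Y i := by
  ext p b
  by_cases h : p.1 = i <;> simp [mask, h]

theorem mask_smul (c : ℝ) (X : Matrix (Fin n × Fin d) (Fin k) ℝ) (i : Fin n) :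
    mask (c • X) i = c • mask X i := by
  ext p b
  by_cases h : p.1 = i <;> simp [mask, h]

theorem mask_mul (X : Matrix (Fin n × Fin d) (Fin k) ℝ) (Y : Matrix (Fin k) (Fin l) ℝ)
    (i : Fin n) : mask (X * Y) i = mask X i * Y := by
  ext p b
  by_cases h : p.1 = i <;> simp [mask, mul_apply, h]

theorem vnorm_mulVec_sq (X : Matrix (Fin n × Fin d) (Fin k) ℝ) (v : Fin k → ℝ) :
    vnorm (X *ᵥ v) ^ 2 = ∑ i, vnorm (blk X i *ᵥ v) ^ 2 := by
  simp only [vnorm_sq, dotProduct, Fintype.sum_prod_type]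
  rfl

theorem vnorm_blk_mulVec_le (X : Matrix (Fin n × Fin d) (Fin k) ℝ) (i : Fin n) (v : Fin k → ℝ) :
    vnorm (blk X i *ᵥ v) ≤ vnorm (X *ᵥ v) := by
  refine le_of_pow_le_pow_left₀ two_ne_zero (vnorm_nonneg _) ?_
  rw [vnorm_mulVec_sq]
  exact Finset.single_le_sum (f := fun i => vnorm (blk X i *ᵥ v) ^ 2)
    (fun j _ => sq_nonneg _) (Finset.mem_univ i)

theorem vnorm_mask_mulVec_le (X : Matrix (Fin n × Fin d) (Fin k) ℝ) (i : Fin n)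
    (v : Fin k → ℝ) : vnorm (mask X i *ᵥ v) ≤ vnorm (X *ᵥ v) := by
  refine le_of_pow_le_pow_left₀ two_ne_zero (vnorm_nonneg _) ?_
  rw [vnorm_mulVec_sq, vnorm_mulVec_sq]
  refine Finset.sum_le_sum fun j _ => ?_
  rw [blk_mask]
  split_ifs
  · rw [zero_mulVec, vnorm_eq_zero.2 rfl, zero_pow two_ne_zero]
    positivity
  · rfl

theorem norm_blk_le (X : Matrix (Fin n × Fin d) (Fin k) ℝ) (i : Fin n) : ‖blk X i‖ ≤ ‖X‖ :=
  norm_le_of_vnorm_mulVec_le (norm_nonneg _) fun v =>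
    (vnorm_blk_mulVec_le X i v).trans (vnorm_mulVec_le X v)

theorem norm_mask_le (X : Matrix (Fin n × Fin d) (Fin k) ℝ) (i : Fin n) : ‖mask X i‖ ≤ ‖X‖ :=
  norm_le_of_vnorm_mulVec_le (norm_nonneg _) fun v =>
    (vnorm_mask_mulVec_le X i v).trans (vnorm_mulVec_le X v)

theorem transpose_mul_self_eq_mask_add (X : Matrix (Fin n × Fin d) (Fin k) ℝ) (i : Fin n) :
    Xᵀ * X = (mask X i)ᵀ * mask X i + (blk X i)ᵀ * blk X i := by
  ext a b
  simp only [mul_apply, transpose_apply, Matrix.add_apply, Fintype.sum_prod_type, mask, blk,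
    of_apply]
  rw [← Finset.add_sum_erase _ _ (Finset.mem_univ i), ← Finset.add_sum_erase _ (fun j =>
    ∑ y, (if j = i then 0 else X (j, y) a) * if j = i then 0 else X (j, y) b) (Finset.mem_univ i)]
  simp only [if_true, mul_zero, Finset.sum_const_zero, zero_add]
  rw [add_comm]
  congr 1
  exact Finset.sum_congr rfl fun j hj => by simp [Finset.ne_of_mem_erase hj]

variable {O : Fin n → Matrix (Fin d) (Fin d) ℝ}

theorem vnorm_stack_mulVec (hO : ∀ i, IsOrth (O i)) (v : Fin d → ℝ) :
    vnorm (stack O *ᵥ v) = Real.sqrt n * vnorm v := by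
  rw [← sq_eq_sq₀ (vnorm_nonneg _) (by have := vnorm_nonneg v; positivity), vnorm_mulVec_sq,
    mul_pow, Real.sq_sqrt (by positivity)]
  simp [blk_stack, (hO _).vnorm_mulVec]

theorem vnorm_mask_stack_mulVec (hO : ∀ i, IsOrth (O i)) (i : Fin n) (v : Fin d → ℝ) :
    vnorm (mask (stack O) i *ᵥ v) = Real.sqrt (n - 1) * vnorm v := by
  have hn : (1 : ℝ) ≤ n := by exact_mod_cast i.pos
  rw [← sq_eq_sq₀ (vnorm_nonneg _) (by have := vnorm_nonneg v; positivity), vnorm_mulVec_sq,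
    mul_pow, Real.sq_sqrt (by linarith), ← Finset.add_sum_erase _ _ (Finset.mem_univ i), blk_mask,
    if_pos rfl, zero_mulVec, vnorm_eq_zero.2 rfl, zero_pow two_ne_zero, zero_add,
    Finset.sum_congr rfl fun j hj => by
      rw [blk_mask, if_neg (Finset.ne_of_mem_erase hj), blk_stack, (hO j).vnorm_mulVec],
    Finset.sum_const, Finset.card_erase_of_mem (Finset.mem_univ i), Finset.card_univ,
    Fintype.card_fin, nsmul_eq_mul, Nat.cast_pred i.pos]

end Blocks

section Deterministic

open scoped Matrix.Norms.L2Operator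

theorem dotProduct_gram_mulVec {ι κ : Type*} [Fintype ι] [Fintype κ] (X : Matrix ι κ ℝ)
    (v : κ → ℝ) : v ⬝ᵥ (Xᵀ * X) *ᵥ v = vnorm (X *ᵥ v) ^ 2 := by
  rw [← mulVec_mulVec, dotProduct_transpose_mulVec, vnorm_sq]

theorem dotProduct_gram_mulVec' {ι κ : Type*} [Fintype ι] [Fintype κ] (X : Matrix ι κ ℝ)
    (v : ι → ℝ) : v ⬝ᵥ (X * Xᵀ) *ᵥ v = vnorm (Xᵀ *ᵥ v) ^ 2 := by
  rw [← dotProduct_gram_mulVec, transpose_transpose]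

variable {n d m : ℕ} {A : Matrix (Fin d) (Fin m) ℝ} {O : Fin n → Matrix (Fin d) (Fin d) ℝ}
  {W : Matrix (Fin n × Fin d) (Fin m) ℝ} {σ s u : ℝ}

theorem stack_transpose_mul_stack (hO : ∀ i, IsOrth (O i)) :
    (stack O)ᵀ * stack O = (n : ℝ) • (1 : Matrix (Fin d) (Fin d) ℝ) := by
  ext a b
  have h : ∀ i, ∑ c, O i c a * O i c b = (1 : Matrix (Fin d) (Fin d) ℝ) a b := fun i => by
    rw [← (hO i).1, mul_apply]
    rfl
  simp [mul_apply, Fintype.sum_prod_type, stack, h]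

theorem vnorm_smul_mulVec_le (hσ : 0 ≤ σ) {ι κ : Type*} [Fintype ι] [Fintype κ] [DecidableEq κ]
    {X : Matrix ι κ ℝ} (hX : σ * ‖X‖ ≤ u) (v : κ → ℝ) : vnorm (σ • (X *ᵥ v)) ≤ u * vnorm v := by
  rw [vnorm_smul, abs_of_nonneg hσ]
  calc σ * vnorm (X *ᵥ v) ≤ σ * (‖X‖ * vnorm v) :=
        mul_le_mul_of_nonneg_left (vnorm_mulVec_le X v) hσ
    _ = σ * ‖X‖ * vnorm v := by ring
    _ ≤ u * vnorm v := mul_le_mul_of_nonneg_right hX (vnorm_nonneg v)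

theorem signal_lower_bound (hO : ∀ i, IsOrth (O i)) (hA : ∀ v, s * vnorm v ≤ vnorm (Aᵀ *ᵥ v))
    (hσ : 0 ≤ σ) (hW : σ * ‖W‖ ≤ u) (y : Fin d → ℝ) :
    (Real.sqrt n * s - u) * vnorm (stack O *ᵥ y) ≤
      vnorm ((stack O * A + σ • W)ᵀ *ᵥ (stack O *ᵥ y)) := by
  have h1 : (stack O * A + σ • W)ᵀ *ᵥ (stack O *ᵥ y) =
      (n : ℝ) • (Aᵀ *ᵥ y) + σ • (Wᵀ *ᵥ (stack O *ᵥ y)) := by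
    rw [transpose_add, add_mulVec, transpose_mul, mulVec_mulVec, Matrix.mul_assoc,
      stack_transpose_mul_stack hO, Matrix.mul_smul, Matrix.mul_one, smul_mulVec, transpose_smul,
      smul_mulVec]
  have h2 := vnorm_sub_le ((n : ℝ) • (Aᵀ *ᵥ y)) (σ • (Wᵀ *ᵥ (stack O *ᵥ y)))
  have h3 := vnorm_smul_mulVec_le hσ (X := Wᵀ) (u := u) (by rwa [norm_transpose]) (stack O *ᵥ y)
  have h4 := mul_le_mul_of_nonneg_left (hA y) (Nat.cast_nonneg (α := ℝ) n)
  rw [← h1, vnorm_smul, abs_of_nonneg (Nat.cast_nonneg _)] at h2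
  have h5 : (Real.sqrt n * s) * vnorm (stack O *ᵥ y) = n * (s * vnorm y) := by
    rw [vnorm_stack_mulVec hO]
    linear_combination (s * vnorm y) * Real.mul_self_sqrt (Nat.cast_nonneg (α := ℝ) n)
  linarith

theorem masked_lower_bound (hO : ∀ i, IsOrth (O i)) (hA : ∀ v, s * vnorm v ≤ vnorm (Aᵀ *ᵥ v))
    (hσ : 0 ≤ σ) (hW : σ * ‖W‖ ≤ u) (i : Fin n) (y : Fin d → ℝ) :
    (Real.sqrt (n - 1) * s - u) * vnorm (Aᵀ *ᵥ y) ≤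
      vnorm (mask (stack O * A + σ • W) i *ᵥ (Aᵀ *ᵥ y)) := by
  have h1 : mask (stack O * A + σ • W) i *ᵥ (Aᵀ *ᵥ y) =
      mask (stack O) i *ᵥ (A *ᵥ (Aᵀ *ᵥ y)) + σ • (mask W i *ᵥ (Aᵀ *ᵥ y)) := by
    rw [mask_add, mask_mul, mask_smul, add_mulVec, smul_mulVec, ← mulVec_mulVec]
  have h2 := vnorm_sub_le (mask (stack O) i *ᵥ (A *ᵥ (Aᵀ *ᵥ y))) (σ • (mask W i *ᵥ (Aᵀ *ᵥ y)))
  have h3 := vnorm_smul_mulVec_le hσ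
    ((mul_le_mul_of_nonneg_left (norm_mask_le W i) hσ).trans hW) (Aᵀ *ᵥ y)
  rw [← h1, vnorm_mask_stack_mulVec hO] at h2
  have h4 : s * vnorm (Aᵀ *ᵥ y) ≤ vnorm (A *ᵥ (Aᵀ *ᵥ y)) := by
    rcases eq_or_ne y 0 with rfl | hy
    · simp [vnorm_eq_zero.2]
    have h5 := dotProduct_le_vnorm y (A *ᵥ (Aᵀ *ᵥ y))
    rw [mulVec_mulVec, dotProduct_gram_mulVec', ← mulVec_mulVec] at h5
    have h6 := mul_le_mul_of_nonneg_right (hA y) (vnorm_nonneg (Aᵀ *ᵥ y))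
    refine le_of_mul_le_mul_left ?_ (vnorm_pos hy)
    linarith
  have h7 := mul_le_mul_of_nonneg_left h4 (Real.sqrt_nonneg ((n : ℝ) - 1))
  linarith

theorem masked_upper_bound (hσ : 0 ≤ σ) (hW : σ * ‖W‖ ≤ u) (i : Fin n) {w : Fin m → ℝ}
    (hw : A *ᵥ w = 0) : vnorm (mask (stack O * A + σ • W) i *ᵥ w) ≤ u * vnorm w := by
  rw [mask_add, mask_mul, mask_smul, add_mulVec, smul_mulVec, ← mulVec_mulVec, hw, mulVec_zero,
    zero_add]
  exact vnorm_smul_mulVec_le hσ ((mul_le_mul_of_nonneg_left (norm_mask_le W i) hσ).trans hW) w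

theorem sqrt_pred_ge (hn : 2 ≤ n) : 7 / 10 * Real.sqrt n ≤ Real.sqrt (n - 1) := by
  have hn' : (2 : ℝ) ≤ n := by exact_mod_cast hn
  refine Real.le_sqrt_of_sq_le ?_
  rw [mul_pow, Real.sq_sqrt (by positivity)]
  linarith

end Deterministic

section LeaveOneOutBound

open scoped Matrix.Norms.L2Operator

variable {n d m : ℕ} {D : Matrix (Fin n × Fin d) (Fin m) ℝ} {U : Matrix (Fin n × Fin d) (Fin d) ℝ}
  {l : ℝ}

theorem IsTopSingVecs.exists_right_factor (hU : IsTopSingVecs D U) (hl : 0 < l)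
    (hlow : ∀ a, l ^ 2 * (a ⬝ᵥ a) ≤ (U *ᵥ a) ⬝ᵥ (D * Dᵀ) *ᵥ (U *ᵥ a)) :
    ∃ (Y : Matrix (Fin m) (Fin d) ℝ) (H : Matrix (Fin d) (Fin d) ℝ), D * Y = U ∧
      Y * H = Dᵀ * U ∧ (∀ a, l ^ 2 * (a ⬝ᵥ a) ≤ a ⬝ᵥ H *ᵥ a) ∧ l * ‖Y‖ ≤ 1 := by
  have hsymm : (D * Dᵀ).IsSymm := by rw [IsSymm, transpose_mul, transpose_transpose]
  have htop : IsTopEig (D * Dᵀ) U := hU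
  have heq := htop.mul_eq hsymm
  set H := Uᵀ * (D * Dᵀ) * U with hH
  have hHlow : ∀ a, l ^ 2 * (a ⬝ᵥ a) ≤ a ⬝ᵥ H *ᵥ a := fun a => by
    refine (hlow a).trans_eq ?_
    rw [hH, Matrix.mul_assoc, ← mulVec_mulVec _ Uᵀ, dotProduct_transpose_mulVec,
      ← mulVec_mulVec _ (D * Dᵀ)]
  have hinj : Function.Injective H.mulVec := by
    refine (injective_iff_map_eq_zero H.mulVecLin).2 fun a ha => ?_
    rw [mulVecLin_apply] at ha
    have h1 := hHlow a
    rw [ha, dotProduct_zero, ← vnorm_sq] at h1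
    refine vnorm_eq_zero.1 (pow_eq_zero_iff two_ne_zero |>.1 (le_antisymm ?_ (sq_nonneg _)))
    exact nonpos_of_mul_nonpos_right h1 (by positivity)
  obtain ⟨L, hHL⟩ := (mulVec_injective_iff_isUnit.1 hinj).exists_right_inv
  refine ⟨Dᵀ * U * L, H, ?_, ?_, hHlow, ?_⟩
  · rw [← Matrix.mul_assoc, ← Matrix.mul_assoc, heq, Matrix.mul_assoc, hHL, Matrix.mul_one]
  · rw [Matrix.mul_assoc, mul_eq_one_comm.1 hHL, Matrix.mul_one]
  · rw [← le_div_iff₀' hl]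
    refine norm_le_of_vnorm_mulVec_le (by positivity) fun a => ?_
    rw [div_mul_eq_mul_div, one_mul, le_div_iff₀' hl]
    set b := L *ᵥ a with hb
    have hHb : H *ᵥ b = a := by rw [hb, mulVec_mulVec, hHL, one_mulVec]
    set y := vnorm ((Dᵀ * U * L) *ᵥ a) with hy
    have hy2 : y ^ 2 = b ⬝ᵥ H *ᵥ b := by
      rw [hy, ← mulVec_mulVec, ← hb, ← dotProduct_gram_mulVec, hH, transpose_mul,
        transpose_transpose]
      simp only [Matrix.mul_assoc]
    have h1 := hHlow b
    have h2 := dotProduct_le_vnorm b (H *ᵥ b)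
    rw [← hy2, ← vnorm_sq, ← mul_pow] at h1
    rw [← hy2, hHb] at h2
    have h3 : l * vnorm b ≤ y := le_of_pow_le_pow_left₀ two_ne_zero (vnorm_nonneg _) h1
    rcases (vnorm_nonneg ((Dᵀ * U * L) *ᵥ a)).eq_or_lt with h0 | h0
    · rw [hy, ← h0, mul_zero]
      exact vnorm_nonneg a
    · refine le_of_mul_le_mul_right ?_ h0
      nlinarith [mul_le_mul_of_nonneg_right h3 (vnorm_nonneg a)]

theorem SpectralGap.norm_sub_projection_le [NeZero d] {i : Fin n}
    {V Y : Matrix (Fin m) (Fin d) ℝ} {H : Matrix (Fin d) (Fin d) ℝ} {lo hi : ℝ}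
    (hV : SpectralGap ((mask D i)ᵀ * mask D i) V lo hi) (hY : D * Y = U) (hYH : Y * H = Dᵀ * U)
    (hH : ∀ a, l * (a ⬝ᵥ a) ≤ a ⬝ᵥ H *ᵥ a) :
    (l - hi) * ‖Y - V * (Vᵀ * Y)‖ ≤ 2 * (‖blk D i‖ * ‖blk U i‖) := by
  set G := (mask D i)ᵀ * mask D i with hG
  have hGs : G.IsSymm := by rw [hG, IsSymm, transpose_mul, transpose_transpose]
  have hcomm := hV.projection_comm hGs
  have hGY : G * Y = Y * H - (blk D i)ᵀ * blk U i := by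
    rw [hYH, ← hY, blk_mul, ← Matrix.mul_assoc, ← Matrix.mul_assoc, ← Matrix.sub_mul,
      transpose_mul_self_eq_mask_add D i, add_sub_cancel_right]
  have hF : (Y - V * (Vᵀ * Y)) * H - G * (Y - V * (Vᵀ * Y)) =
      (blk D i)ᵀ * blk U i - V * (Vᵀ * ((blk D i)ᵀ * blk U i)) := by
    have h1 : G * (V * (Vᵀ * Y)) = V * (Vᵀ * (G * Y)) := by
      rw [← Matrix.mul_assoc V, ← Matrix.mul_assoc, ← hcomm]
      simp only [Matrix.mul_assoc]
    rw [Matrix.mul_sub, h1, hGY]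
    simp only [Matrix.mul_sub, Matrix.sub_mul, Matrix.mul_assoc]
    abel
  refine (sylvester_norm_le hF hH fun v => hV.upper _ ?_).trans ?_
  · rw [mulVec_mulVec, Matrix.mul_sub, ← Matrix.mul_assoc, hV.orthonormal, Matrix.one_mul, sub_self,
      zero_mulVec]
  · have hVn := norm_le_one_of_transpose_mul_self hV.orthonormal
    have h1 : ‖(blk D i)ᵀ * blk U i‖ ≤ ‖blk D i‖ * ‖blk U i‖ := by
      rw [← norm_transpose (blk D i)]
      exact l2_opNorm_mul _ _
    have h2 : ‖V * (Vᵀ * ((blk D i)ᵀ * blk U i))‖ ≤ ‖(blk D i)ᵀ * blk U i‖ := by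
      refine (l2_opNorm_mul _ _).trans ((mul_le_of_le_one_left (norm_nonneg _) hVn).trans ?_)
      refine (l2_opNorm_mul _ _).trans (mul_le_of_le_one_left (norm_nonneg _) ?_)
      rwa [norm_transpose]
    linarith [norm_sub_le ((blk D i)ᵀ * blk U i) (V * (Vᵀ * ((blk D i)ᵀ * blk U i)))]

end LeaveOneOutBound

theorem leave_one_out_scalar_bound {r κ e z g : ℝ} (hr0 : 0 ≤ r) (hr1 : r ≤ 1) (hκ : 1 ≤ κ)
    (he : 0 ≤ e) (hg : 0 ≤ g) (hκe : κ * e ≤ 1 / 50)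
    (hz : 3 / 4 * z ≤ 2 * ((2 * κ * r + e) * (2 * r + g))) (h : g ≤ 5 / 2 * (e * r) + e * z) :
    g ≤ 37 * (κ * e * r) := by
  have heκ : e ≤ κ * e := le_mul_of_one_le_left he hκ
  have h1 : e * (2 * κ * r + e) ≤ 101 / 50 * (κ * e) := by nlinarith
  have h2 : e * (2 * κ * r + e) ≤ 101 / 2500 := by linarith
  have h3 := mul_le_mul_of_nonneg_left hz he
  have h4 := mul_le_mul_of_nonneg_right h1 hr0
  have h5 := mul_le_mul_of_nonneg_right h2 hg
  have h6 := mul_le_mul_of_nonneg_right heκ hr0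
  have h7 : 0 ≤ κ * e * r := by positivity
  nlinarith

section Deterministic

open scoped Matrix.Norms.L2Operator

variable {n d m : ℕ} {A : Matrix (Fin d) (Fin m) ℝ} {O : Fin n → Matrix (Fin d) (Fin d) ℝ}
  {W : Matrix (Fin n × Fin d) (Fin m) ℝ} {σ s u : ℝ}

theorem exists_transpose_mul_self_eq_one (hdm : d ≤ m) :
    ∃ U : Matrix (Fin m) (Fin d) ℝ, Uᵀ * U = 1 := by
  refine ⟨Matrix.of fun a b => if a = Fin.castLE hdm b then 1 else 0, ?_⟩
  ext a b
  simp [mul_apply, Matrix.one_apply, eq_comm]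

/-- Removing one block of the data preserves the gap between the signal and noise directions. -/
theorem exists_spectralGap_mask (hn : 2 ≤ n) (hdm : d ≤ m) (hO : ∀ i, IsOrth (O i)) (hs : 0 < s)
    (hA : ∀ v, s * vnorm v ≤ vnorm (Aᵀ *ᵥ v)) (hσ : 0 ≤ σ) (hW : σ * ‖W‖ ≤ u)
    (hu : 100 * u ≤ Real.sqrt n * s) (i : Fin n) :
    ∃ V : Matrix (Fin m) (Fin d) ℝ,
      SpectralGap ((mask (stack O * A + σ • W) i)ᵀ * mask (stack O * A + σ • W) i) V
        ((Real.sqrt n * s / 2) ^ 2) ((Real.sqrt n * s / 4) ^ 2) := by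
  set D := stack O * A + σ • W with hD
  have hu0 : 0 ≤ u := (by positivity : 0 ≤ σ * ‖W‖).trans hW
  obtain ⟨V, hV⟩ := exists_isTopEig ((mask D i)ᵀ * mask D i)
    (exists_transpose_mul_self_eq_one hdm)
  refine ⟨V, hV.spectralGap (T := Aᵀ) ?_ (fun y => ?_) (fun y hy => ?_) fun w hw => ?_⟩
  · rw [IsSymm, transpose_mul, transpose_transpose]
  · have h1 := masked_lower_bound hO hA hσ hW i y
    have h2 := mul_le_mul_of_nonneg_right (sqrt_pred_ge hn) hs.le
    have h3 := vnorm_nonneg (Aᵀ *ᵥ y)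
    rw [dotProduct_gram_mulVec, ← vnorm_sq, ← mul_pow]
    refine pow_le_pow_left₀ (by positivity) (le_trans ?_ h1) 2
    exact mul_le_mul_of_nonneg_right (by linarith) h3
  · have h1 := hA y
    rw [hy, vnorm_eq_zero.2 rfl] at h1
    exact vnorm_eq_zero.1 (le_antisymm (nonpos_of_mul_nonpos_right h1 hs) (vnorm_nonneg y))
  · have h1 := masked_upper_bound (O := O) hσ hW i (by rwa [transpose_transpose] at hw)
    have h3 := vnorm_nonneg w
    rw [dotProduct_gram_mulVec, ← vnorm_sq, ← mul_pow]
    refine pow_le_pow_left₀ (vnorm_nonneg _) (h1.trans ?_) 2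
    exact mul_le_mul_of_nonneg_right (by linarith) h3

/-- If the noise is small and every noise block is nearly independent of the right singular
subspaces with that block left out, the blockwise polar factors of the top singular vectors
recover the rotations up to a global rotation. -/
theorem exists_isOrth_blockwise_norm_le [NeZero d] {κ : ℝ} (hn : 2 ≤ n) (hdm : d ≤ m)
    (hO : ∀ i, IsOrth (O i)) (hs : 0 < s) (hA : ∀ v, s * vnorm v ≤ vnorm (Aᵀ *ᵥ v))
    (hκ : 1 ≤ κ) (hAκ : ‖A‖ ≤ κ * s) (hσ : 0 ≤ σ) (hW : σ * ‖W‖ ≤ u)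
    (hu : 100 * (κ * u) ≤ Real.sqrt n * s)
    (hloo : ∀ i, ∀ V : Matrix (Fin m) (Fin d) ℝ,
      SpectralGap ((mask (stack O * A + σ • W) i)ᵀ * mask (stack O * A + σ • W) i) V
        ((Real.sqrt n * s / 2) ^ 2) ((Real.sqrt n * s / 4) ^ 2) →
      σ * ‖blk W i * V‖ ≤ 5 / 2 * (u / Real.sqrt n))
    {U S : Matrix (Fin n × Fin d) (Fin d) ℝ} (hU : IsTopSingVecs (stack O * A + σ • W) U)
    (hS : IsPolarBlocks U S) :
    ∃ Q, IsOrth Q ∧ ∀ i, Real.sqrt n * s * ‖blk S i - O i * Q‖ ≤ 296 * (κ * u) := by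
  set D := stack O * A + σ • W with hD
  set R := Real.sqrt n with hR
  have hn' : (2 : ℝ) ≤ n := by exact_mod_cast hn
  have hR1 : 1 ≤ R := Real.one_le_sqrt.2 (by linarith)
  have hR0 : 0 < R := by linarith
  have hu0 : 0 ≤ u := (by positivity : 0 ≤ σ * ‖W‖).trans hW
  have huκ : u ≤ κ * u := le_mul_of_one_le_left hu0 hκ
  set l := R * s / 2 with hl
  have hl0 : 0 < l := by positivity
  set e := u / l with he
  have he0 : 0 ≤ e := by positivity
  have hel : e * l = u := div_mul_cancel₀ u hl0.ne'
  have hκe : κ * e ≤ 1 / 50 := by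
    rw [he, mul_div_assoc', div_le_iff₀ hl0]
    linarith
  have he1 : e ≤ 1 / 50 := (le_mul_of_one_le_left he0 hκ).trans hκe
  obtain ⟨Y, H, hDY, hYH, hH, hY⟩ : ∃ (Y : Matrix (Fin m) (Fin d) ℝ)
      (H : Matrix (Fin d) (Fin d) ℝ), D * Y = U ∧ Y * H = Dᵀ * U ∧
      (∀ a, l ^ 2 * (a ⬝ᵥ a) ≤ a ⬝ᵥ H *ᵥ a) ∧ l * ‖Y‖ ≤ 1 := by
    refine hU.exists_right_factor hl0 (IsTopEig.lower_bound hU ?_ (T := stack O) (fun y => ?_)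
      fun y hy => ?_)
    · rw [IsSymm, transpose_mul, transpose_transpose]
    · rw [dotProduct_gram_mulVec', ← vnorm_sq, ← mul_pow]
      have h3 := vnorm_nonneg (stack O *ᵥ y)
      refine pow_le_pow_left₀ (by positivity) (le_trans ?_ (signal_lower_bound hO hA hσ hW y)) 2
      exact mul_le_mul_of_nonneg_right (by linarith) h3
    · have h1 := vnorm_stack_mulVec hO y
      rw [hy, vnorm_eq_zero.2 rfl, zero_eq_mul] at h1
      exact vnorm_eq_zero.1 (h1.resolve_left hR0.ne')
  set B := A * Y with hB
  have hBv : ∀ v, |R * vnorm (B *ᵥ v) - vnorm v| ≤ e * vnorm v := fun v => by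
    have h1 : U *ᵥ v = stack O *ᵥ (B *ᵥ v) + σ • (W *ᵥ (Y *ᵥ v)) := by
      rw [← hDY, hD, Matrix.add_mul, add_mulVec, Matrix.mul_assoc, ← hB, smul_mul, smul_mulVec,
        mulVec_mulVec, mulVec_mulVec]
    have h2 : vnorm (U *ᵥ v) = vnorm v := by
      rw [← sq_eq_sq₀ (vnorm_nonneg _) (vnorm_nonneg _), vnorm_sq, vnorm_sq,
        dotProduct_mulVec_of_transpose_mul_self hU.1]
    have h3 : vnorm (σ • (W *ᵥ (Y *ᵥ v))) ≤ e * vnorm v := by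
      refine (vnorm_smul_mulVec_le hσ hW _).trans ?_
      rw [← hel, mul_assoc]
      refine mul_le_mul_of_nonneg_left ?_ he0
      have h4 := mul_le_mul_of_nonneg_left (vnorm_mulVec_le Y v) hl0.le
      have h5 := mul_le_mul_of_nonneg_right hY (vnorm_nonneg v)
      linarith
    have h6 := vnorm_add_le (stack O *ᵥ (B *ᵥ v)) (σ • (W *ᵥ (Y *ᵥ v)))
    have h7 := vnorm_sub_le (stack O *ᵥ (B *ᵥ v)) (σ • (W *ᵥ (Y *ᵥ v)))
    rw [← h1, h2, vnorm_stack_mulVec hO] at h6 h7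
    rw [abs_le]
    constructor <;> linarith
  have hBnorm : ‖B‖ ≤ 2 * R⁻¹ := norm_le_of_vnorm_mulVec_le (by positivity) fun v => by
    have h1 := (abs_le.1 (hBv v)).2
    have h2 := mul_le_mul_of_nonneg_right he1 (vnorm_nonneg v)
    have h3 := vnorm_nonneg v
    rw [mul_right_comm, ← div_eq_mul_inv, le_div_iff₀' hR0]
    linarith
  obtain ⟨Q, hQ⟩ := exists_isPolar B
  refine ⟨Q, hQ.1, fun i => ?_⟩
  have hblk : blk U i - O i * B = σ • (blk W i * Y) := by
    rw [← hDY, blk_mul, hD, blk_add, blk_mul, blk_stack, blk_smul, Matrix.add_mul, smul_mul,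
      Matrix.mul_assoc, add_sub_cancel_left]
  set g := ‖blk U i - O i * B‖ with hg
  have hgσ : g = σ * ‖blk W i * Y‖ := by
    rw [hg, hblk, norm_smul, Real.norm_of_nonneg hσ]
  have hOi : ‖O i‖ ≤ 1 := norm_le_one_of_transpose_mul_self (hO i).1
  have hgκ : g ≤ 37 * (κ * e * R⁻¹) := by
    obtain ⟨V, hV⟩ := exists_spectralGap_mask hn hdm hO hs hA hσ hW (by linarith) i
    have hVn := norm_le_one_of_transpose_mul_self hV.orthonormal
    set X := Y - V * (Vᵀ * Y) with hX
    have h1 := hV.norm_sub_projection_le hDY hYH hH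
    rw [← hX] at h1
    have hDi : ‖blk D i‖ ≤ 2 * κ * l * R⁻¹ + e * l := by
      have h2 : blk D i = O i * A + σ • blk W i := by
        rw [hD, blk_add, blk_mul, blk_stack, blk_smul]
      have h3 : 2 * κ * l * R⁻¹ = κ * s := by
        rw [hl]
        field_simp
      have h4 : ‖O i * A‖ ≤ κ * s :=
        (l2_opNorm_mul _ _).trans ((mul_le_of_le_one_left (norm_nonneg _) hOi).trans hAκ)
      have h5 : ‖σ • blk W i‖ ≤ u := by
        rw [norm_smul, Real.norm_of_nonneg hσ]
        exact (mul_le_mul_of_nonneg_left (norm_blk_le W i) hσ).trans hW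
      rw [h2, h3, hel]
      exact (norm_add_le _ _).trans (add_le_add h4 h5)
    have hUi : ‖blk U i‖ ≤ 2 * R⁻¹ + g := by
      have h2 : ‖O i * B‖ ≤ 2 * R⁻¹ :=
        (l2_opNorm_mul _ _).trans ((mul_le_of_le_one_left (norm_nonneg _) hOi).trans hBnorm)
      have h3 := norm_add_le (O i * B) (blk U i - O i * B)
      rw [add_sub_cancel] at h3
      linarith
    refine leave_one_out_scalar_bound (z := l * ‖X‖) (by positivity) (inv_le_one_of_one_le₀ hR1)
      hκ he0 (norm_nonneg _) hκe ?_ ?_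
    · have h2 := mul_le_mul hDi hUi (norm_nonneg _) (by positivity)
      refine le_of_mul_le_mul_left ?_ hl0
      have h3 : (R * s / 4) ^ 2 = l ^ 2 / 4 := by rw [hl]; ring
      rw [h3] at h1
      linarith
    · have h2 : blk W i * Y = (blk W i * V) * (Vᵀ * Y) + blk W i * X := by
        rw [hX, Matrix.mul_sub, Matrix.mul_assoc, add_sub_cancel]
      have h3 : ‖Vᵀ * Y‖ ≤ 1 / l := by
        refine (l2_opNorm_mul _ _).trans ?_
        rw [norm_transpose]
        refine (mul_le_of_le_one_left (norm_nonneg _) hVn).trans ?_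
        rwa [le_div_iff₀' hl0]
      have h4 : σ * ‖(blk W i * V) * (Vᵀ * Y)‖ ≤ 5 / 2 * (u / R) * (1 / l) := by
        refine (mul_le_mul_of_nonneg_left (l2_opNorm_mul _ _) hσ).trans ?_
        rw [← mul_assoc]
        exact mul_le_mul (hloo i V hV) h3 (norm_nonneg _) (by positivity)
      have h5 : σ * ‖blk W i * X‖ ≤ u * ‖X‖ := by
        refine (mul_le_mul_of_nonneg_left (l2_opNorm_mul _ _) hσ).trans ?_
        rw [← mul_assoc]
        exact mul_le_mul_of_nonneg_right
          ((mul_le_mul_of_nonneg_left (norm_blk_le W i) hσ).trans hW) (norm_nonneg _)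
      have h6 := mul_le_mul_of_nonneg_left (norm_add_le ((blk W i * V) * (Vᵀ * Y)) (blk W i * X)) hσ
      rw [← h2, ← hgσ] at h6
      have h7 : 5 / 2 * (u / R) * (1 / l) = 5 / 2 * (e * R⁻¹) := by rw [he]; ring
      rw [← mul_assoc e, hel]
      linarith
  have hpolar : 1 / (2 * R) * ‖blk S i - O i * Q‖ ≤ 2 * g :=
    IsPolar.norm_sub_le (hS i) (hQ.mul_left (hO i)) fun v => by
      rw [← mulVec_mulVec, (hO i).vnorm_mulVec]
      have h1 := (abs_le.1 (hBv v)).1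
      have h2 := mul_le_mul_of_nonneg_right he1 (vnorm_nonneg v)
      have h3 := vnorm_nonneg v
      rw [div_mul_eq_mul_div, div_le_iff₀ (by positivity)]
      linarith
  rw [div_mul_eq_mul_div, one_mul, div_le_iff₀ (by positivity)] at hpolar
  have h1 : g * R ≤ 37 * (κ * e) := by
    have := mul_le_mul_of_nonneg_right hgκ hR0.le
    rwa [mul_assoc, mul_assoc (κ * e), inv_mul_cancel₀ hR0.ne', mul_one] at this
  have h2 : R * s * ‖blk S i - O i * Q‖ ≤ R * s * (148 * (κ * e)) :=
    mul_le_mul_of_nonneg_left (by linarith) (by positivity)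
  have h3 : R * s * (148 * (κ * e)) = 296 * (κ * u) := by rw [← hel, hl]; ring
  exact h2.trans_eq h3

end Deterministic

theorem five_pow_mul_exp_le {n k : ℕ} {γ t : ℝ} (hn : 1 ≤ n)
    (ht : 4 * k + 2 * γ * Real.log n ≤ t ^ 2) :
    5 ^ k * Real.exp (-(t ^ 2 / 2)) ≤ (n : ℝ) ^ (-γ) := by
  have hn0 : (0 : ℝ) < n := by exact_mod_cast hn
  have h5 : (5 : ℝ) ≤ Real.exp 2 := by
    have h1 := Real.exp_one_gt_d9
    have h2 : Real.exp 2 = Real.exp 1 * Real.exp 1 := by rw [← Real.exp_add]; norm_num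
    rw [h2]
    nlinarith
  calc 5 ^ k * Real.exp (-(t ^ 2 / 2)) ≤ Real.exp 2 ^ k * Real.exp (-(t ^ 2 / 2)) :=
        mul_le_mul_of_nonneg_right (pow_le_pow_left₀ (by norm_num) h5 k) (Real.exp_pos _).le
    _ = Real.exp (k * 2 + -(t ^ 2 / 2)) := by rw [← Real.exp_nat_mul, ← Real.exp_add]
    _ ≤ Real.exp (Real.log n * -γ) := Real.exp_le_exp.2 (by linarith)
    _ = (n : ℝ) ^ (-γ) := (Real.rpow_def_of_pos hn0 _).symm

theorem bnd1_nonneg (n d m : ℕ) (γ : ℝ) : 0 ≤ bnd1 n d m γ := by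
  unfold bnd1
  positivity

section Probability

open scoped Matrix.Norms.L2Operator

variable {n d m : ℕ} {γ : ℝ}

theorem stdGaussian_norm_gt_le (hn : 1 ≤ n) (hγ : 0 ≤ γ) :
    stdGaussian (Fin n × Fin d) (Fin m)
      {W | 8 * bnd1 n d m γ < ‖(Matrix.of W : Matrix (Fin n × Fin d) (Fin m) ℝ)‖} ≤
      ENNReal.ofReal ((n : ℝ) ^ (-γ)) := by
  have hn1 : (1 : ℝ) ≤ n := by exact_mod_cast hn
  have hlog : 0 ≤ Real.log n := Real.log_nonneg hn1
  set t := 2 * Real.sqrt (n * d) + 2 * Real.sqrt m + Real.sqrt (2 * γ * Real.log n) with ht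
  have h1 : stdGaussian (Fin n × Fin d) (Fin m) _ ≤ _ :=
    stdGaussian_norm_tail (ι := Fin n × Fin d) (V := (1 : Matrix (Fin m) (Fin m) ℝ))
      (norm_le_one_of_transpose_mul_self (by simp)) (t := t) (by positivity)
  refine le_trans (measure_mono fun W hW => ?_) (h1.trans (ENNReal.ofReal_le_ofReal
    (five_pow_mul_exp_le hn ?_)))
  · have h2 : Real.sqrt (2 * γ * Real.log n) ≤ Real.sqrt (2 * γ * n * Real.log n) := by
      refine Real.sqrt_le_sqrt (mul_le_mul_of_nonneg_right ?_ hlog)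
      exact le_mul_of_one_le_right (by positivity) hn1
    have h3 := Real.sqrt_nonneg (2 * γ * n * Real.log n)
    have hW' : 8 * bnd1 n d m γ < ‖(Matrix.of W : Matrix (Fin n × Fin d) (Fin m) ℝ)‖ := hW
    change 4 * t < ‖(Matrix.of W : Matrix (Fin n × Fin d) (Fin m) ℝ) * 1‖
    rw [Matrix.mul_one]
    refine lt_of_le_of_lt ?_ hW'
    unfold bnd1
    linarith
  · simp only [Fintype.card_prod, Fintype.card_fin, Nat.cast_add, Nat.cast_mul]
    have h2 := Real.sq_sqrt (by positivity : (0 : ℝ) ≤ n * d)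
    have h3 := Real.sq_sqrt (by positivity : (0 : ℝ) ≤ m)
    have h4 := Real.sq_sqrt (by positivity : (0 : ℝ) ≤ 2 * γ * Real.log n)
    have h5 : 0 ≤ 2 * (Real.sqrt (n * d) * Real.sqrt m) +
        Real.sqrt (n * d) * Real.sqrt (2 * γ * Real.log n) +
        Real.sqrt m * Real.sqrt (2 * γ * Real.log n) := by positivity
    rw [ht]
    nlinarith

theorem stdGaussian_blk_mul_gt_le [NeZero d] (hn : 1 ≤ n) (hγ : 0 ≤ γ)
    (M : Matrix (Fin n × Fin d) (Fin m) ℝ) (σ : ℝ) {lo hi : ℝ} (hlt : hi < lo) (i : Fin n) :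
    stdGaussian (Fin n × Fin d) (Fin m) {W | ∃ V : Matrix (Fin m) (Fin d) ℝ,
      SpectralGap ((mask (M + σ • Matrix.of W) i)ᵀ * mask (M + σ • Matrix.of W) i) V lo hi ∧
        20 * bnd1 n d m γ / Real.sqrt n < ‖blk (Matrix.of W) i * V‖} ≤
      ENNReal.ofReal ((n : ℝ) ^ (-γ)) := by
  have hn1 : (1 : ℝ) ≤ n := by exact_mod_cast hn
  have hR : 0 < Real.sqrt n := Real.sqrt_pos.2 (by linarith)
  have hlog : 0 ≤ Real.log n := Real.log_nonneg hn1
  have hd : (0 : ℝ) < d := by exact_mod_cast NeZero.pos d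
  set t := 4 * Real.sqrt d + Real.sqrt (2 * γ * Real.log n) with ht
  let e : Fin d ≃ {x : Fin n × Fin d // x.1 = i} :=
    ⟨fun a => ⟨(i, a), rfl⟩, fun x => x.1.2, fun _ => rfl, by rintro ⟨⟨_, a⟩, rfl⟩; rfl⟩
  have h1 := stdGaussian_leave_out (ι := Fin n × Fin d) (κ := Fin m) (μ := Fin d)
    (fun x => x.1 = i)
    (M := fun W => (mask (M + σ • Matrix.of W) i)ᵀ * mask (M + σ • Matrix.of W) i) ?_ ?_ ?_
    hlt (t := t) (by positivity)
  · refine le_trans (measure_mono ?_) (h1.trans (ENNReal.ofReal_le_ofReal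
      (five_pow_mul_exp_le hn ?_)))
    · rintro W ⟨V, hV, hW⟩
      refine ⟨V, hV, le_trans ?_ (hW.le.trans ?_)⟩
      · rw [le_div_iff₀ hR, ht]
        have h2 : Real.sqrt (n * d) = Real.sqrt n * Real.sqrt d := Real.sqrt_mul (by positivity) _
        have h3 : Real.sqrt (2 * γ * n * Real.log n) =
            Real.sqrt n * Real.sqrt (2 * γ * Real.log n) := by
          rw [← Real.sqrt_mul (by positivity)]
          congr 1
          ring
        have h4 : 0 ≤ Real.sqrt n * Real.sqrt (2 * γ * Real.log n) := by positivity
        have h5 := Real.sqrt_nonneg (m : ℝ)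
        unfold bnd1
        rw [h2, h3]
        linarith
      · refine norm_le_of_vnorm_mulVec_le (norm_nonneg _) fun v => le_trans (le_of_eq ?_)
          (vnorm_mulVec_le _ v)
        unfold vnorm
        congr 1
        exact Fintype.sum_equiv e _ _ fun a => rfl
    · rw [← Fintype.card_congr e, Fintype.card_fin]
      push_cast
      have h2 := Real.sq_sqrt hd.le
      have h4 := Real.sq_sqrt (by positivity : (0 : ℝ) ≤ 2 * γ * Real.log n)
      have h5 : 0 ≤ Real.sqrt d * Real.sqrt (2 * γ * Real.log n) := by positivity
      rw [ht]
      nlinarith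
  · have h2 : Continuous fun W : Fin n × Fin d → Fin m → ℝ => mask (M + σ • Matrix.of W) i := by
      refine continuous_pi fun x => continuous_pi fun b => ?_
      by_cases hx : x.1 = i
      · simp only [mask, of_apply, hx, if_true]
        exact continuous_const
      · simp only [mask, of_apply, hx, if_false, Matrix.add_apply, Matrix.smul_apply]
        fun_prop
    fun_prop
  · intro W
    rw [IsSymm, transpose_mul, transpose_transpose]
  · intro W W' h
    have h2 : mask (M + σ • Matrix.of W) i = mask (M + σ • Matrix.of W') i := by
      ext x b
      by_cases hx : x.1 = i
      · simp [mask, hx]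
      · simp [mask, hx, h x hx]
    simp only [h2]

end Probability

section Main

open scoped Matrix.Norms.L2Operator

variable {n d m : ℕ} {A : Matrix (Fin d) (Fin m) ℝ} {O : Fin n → Matrix (Fin d) (Fin d) ℝ}
  {σ γ : ℝ}

theorem one_le_kappa [NeZero d] (hA : 0 < sigmaMin A) : 1 ≤ kappa A := by
  have hv : (Pi.single 0 1 : Fin d → ℝ) ≠ 0 := by simp
  have h1 := (sigmaMin_mul_vnorm_le A _).trans (vnorm_mulVec_le Aᵀ (Pi.single 0 1))
  have h2 := le_of_mul_le_mul_right h1 (vnorm_pos hv)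
  rw [norm_transpose] at h2
  rw [kappa, one_le_div hA]
  exact h2.trans (norm_le_opNorm A)

theorem spectral_good_event [NeZero d] (hn : 2 ≤ n) (hdm : d ≤ m) (hA : 0 < sigmaMin A)
    (hO : ∀ i, IsOrth (O i)) (hσ : 0 < σ)
    (hnoise : σ ≤ 1 / 1000 * (sigmaMin A / kappa A ^ 4) * Real.sqrt n / bnd1 n d m γ)
    {W : Matrix (Fin n × Fin d) (Fin m) ℝ} (hW : ‖W‖ ≤ 8 * bnd1 n d m γ)
    (hloo : ∀ i, ∀ V : Matrix (Fin m) (Fin d) ℝ,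
      SpectralGap ((mask (stack O * A + σ • W) i)ᵀ * mask (stack O * A + σ • W) i) V
        ((Real.sqrt n * sigmaMin A / 2) ^ 2) ((Real.sqrt n * sigmaMin A / 4) ^ 2) →
      ‖blk W i * V‖ ≤ 20 * bnd1 n d m γ / Real.sqrt n)
    {U S : Matrix (Fin n × Fin d) (Fin d) ℝ} (hU : IsTopSingVecs (stack O * A + σ • W) U)
    (hS : IsPolarBlocks U S) :
    ∃ Q, IsOrth Q ∧ ∀ i, opNorm (blk S i - O i * Q) ≤
      3000 * (σ * kappa A ^ 2 / sigmaMin A) * bnd1 n d m γ / Real.sqrt n := by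
  have hR : 0 < Real.sqrt n := Real.sqrt_pos.2 (by exact_mod_cast (by omega : 0 < n))
  have hκ := one_le_kappa hA
  have hβ0 := bnd1_nonneg n d m γ
  set β := bnd1 n d m γ
  set κ := kappa A with hκdef
  set s := sigmaMin A
  have hβ : 0 < β := by
    refine hβ0.lt_of_ne fun h => ?_
    rw [← h, div_zero] at hnoise
    exact hnoise.not_gt hσ
  have hAκ : ‖A‖ ≤ κ * s := by
    rw [hκdef, kappa, div_mul_cancel₀ _ hA.ne']
    exact norm_le_opNorm A
  have hsmall : 100 * (κ * (σ * (8 * β))) ≤ Real.sqrt n * s := by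
    rw [le_div_iff₀ hβ, mul_right_comm, mul_div_assoc', le_div_iff₀ (by positivity)] at hnoise
    have h1 : κ ≤ κ ^ 4 := le_self_pow₀ hκ (by norm_num)
    have h2 := mul_le_mul_of_nonneg_left h1 (by positivity : 0 ≤ σ * β)
    have h3 : 0 ≤ κ * (σ * β) := by positivity
    linarith
  obtain ⟨Q, hQ, h⟩ := exists_isOrth_blockwise_norm_le hn hdm hO hA (sigmaMin_mul_vnorm_le A) hκ hAκ
    hσ.le (mul_le_mul_of_nonneg_left hW hσ.le) hsmall (fun i V hV => by
      refine (mul_le_mul_of_nonneg_left (hloo i V hV) hσ.le).trans_eq ?_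
      ring) hU hS
  refine ⟨Q, hQ, fun i => (opNorm_le_norm _).trans ?_⟩
  have h1 : 3000 * (σ * κ ^ 2 / s) * β / Real.sqrt n = 3000 * (κ ^ 2 * (σ * β)) /
      (Real.sqrt n * s) := by
    field_simp
  rw [h1, le_div_iff₀' (by positivity)]
  refine (h i).trans ?_
  have h2 : κ ≤ κ ^ 2 := le_self_pow₀ hκ (by norm_num)
  have h3 := mul_le_mul_of_nonneg_right h2 (by positivity : 0 ≤ σ * β)
  have h4 : 0 ≤ κ * (σ * β) := by positivity
  linarith

theorem stdGaussian_spectral_good_event [NeZero d] (hn : 2 ≤ n) (hdm : d ≤ m)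
    (hA : 0 < sigmaMin A) (hO : ∀ i, IsOrth (O i)) (hσ : 0 < σ) (hγ : 0 ≤ γ)
    (hnoise : σ ≤ 1 / 1000 * (sigmaMin A / kappa A ^ 4) * Real.sqrt n / bnd1 n d m γ) :
    ENNReal.ofReal (1 - 3000 * (n : ℝ) ^ (-γ + 2)) ≤
      stdGaussian (Fin n × Fin d) (Fin m) {W | ∀ U S0 : Matrix (Fin n × Fin d) (Fin d) ℝ,
        IsTopSingVecs (stack O * A + σ • Matrix.of W) U → IsPolarBlocks U S0 →
        ∃ Q : Matrix (Fin d) (Fin d) ℝ, IsOrth Q ∧ ∀ i, opNorm (blk S0 i - O i * Q) ≤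
          3000 * (σ * kappa A ^ 2 / sigmaMin A) * bnd1 n d m γ / Real.sqrt n} := by
  set good := {W : Fin n × Fin d → Fin m → ℝ | ∀ U S0 : Matrix (Fin n × Fin d) (Fin d) ℝ,
    IsTopSingVecs (stack O * A + σ • Matrix.of W) U → IsPolarBlocks U S0 →
    ∃ Q : Matrix (Fin d) (Fin d) ℝ, IsOrth Q ∧ ∀ i, opNorm (blk S0 i - O i * Q) ≤
      3000 * (σ * kappa A ^ 2 / sigmaMin A) * bnd1 n d m γ / Real.sqrt n} with hgood
  set bad₀ := {W : Fin n × Fin d → Fin m → ℝ |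
    8 * bnd1 n d m γ < ‖(Matrix.of W : Matrix (Fin n × Fin d) (Fin m) ℝ)‖} with hbad₀
  set bad := fun i : Fin n => {W : Fin n × Fin d → Fin m → ℝ | ∃ V : Matrix (Fin m) (Fin d) ℝ,
    SpectralGap ((mask (stack O * A + σ • Matrix.of W) i)ᵀ *
      mask (stack O * A + σ • Matrix.of W) i) V
      ((Real.sqrt n * sigmaMin A / 2) ^ 2) ((Real.sqrt n * sigmaMin A / 4) ^ 2) ∧
      20 * bnd1 n d m γ / Real.sqrt n < ‖blk (Matrix.of W) i * V‖} with hbad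
  have hn0 : (2 : ℝ) ≤ n := by exact_mod_cast hn
  have hcover : Set.univ ⊆ good ∪ (bad₀ ∪ ⋃ i, bad i) := by
    intro W _
    by_cases h0 : W ∈ bad₀
    · exact Or.inr (Or.inl h0)
    by_cases h1 : W ∈ ⋃ i, bad i
    · exact Or.inr (Or.inr h1)
    rw [Set.mem_iUnion, not_exists] at h1
    exact Or.inl fun U S hU hS => spectral_good_event hn hdm hA hO hσ hnoise (not_lt.1 h0)
      (fun i V hV => not_lt.1 fun hlt => h1 i ⟨V, hV, hlt⟩) hU hS
  have hbadle : stdGaussian (Fin n × Fin d) (Fin m) (bad₀ ∪ ⋃ i, bad i) ≤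
      ENNReal.ofReal (3000 * (n : ℝ) ^ (-γ + 2)) := by
    have hp : (0 : ℝ) ≤ (n : ℝ) ^ (-γ) := by positivity
    have hR : 0 < Real.sqrt n := Real.sqrt_pos.2 (by linarith)
    have hlt : (Real.sqrt n * sigmaMin A / 4) ^ 2 < (Real.sqrt n * sigmaMin A / 2) ^ 2 := by
      have : 0 < Real.sqrt n * sigmaMin A := by positivity
      exact pow_lt_pow_left₀ (by linarith) (by positivity) two_ne_zero
    calc stdGaussian (Fin n × Fin d) (Fin m) (bad₀ ∪ ⋃ i, bad i)
        ≤ ENNReal.ofReal ((n : ℝ) ^ (-γ)) + ∑ _i : Fin n, ENNReal.ofReal ((n : ℝ) ^ (-γ)) := by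
          refine (measure_union_le _ _).trans (add_le_add ?_ ?_)
          · exact stdGaussian_norm_gt_le (by omega) hγ
          · refine (measure_iUnion_fintype_le _ _).trans (Finset.sum_le_sum fun i _ => ?_)
            exact stdGaussian_blk_mul_gt_le (by omega) hγ _ σ hlt i
      _ = ENNReal.ofReal ((1 + n) * (n : ℝ) ^ (-γ)) := by
          rw [← ENNReal.ofReal_sum_of_nonneg fun _ _ => hp, ← ENNReal.ofReal_add hp (by positivity),
            Finset.sum_const, Finset.card_univ, Fintype.card_fin, nsmul_eq_mul, add_mul, one_mul]
      _ ≤ ENNReal.ofReal (3000 * (n : ℝ) ^ (-γ + 2)) := by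
          rw [Real.rpow_add (by linarith), Real.rpow_two]
          refine ENNReal.ofReal_le_ofReal ?_
          have : (1 + n : ℝ) ≤ 3000 * n ^ 2 := by nlinarith
          linarith [mul_le_mul_of_nonneg_right this hp]
  rw [ENNReal.ofReal_sub _ (by positivity), ENNReal.ofReal_one, tsub_le_iff_right]
  calc (1 : ENNReal) = stdGaussian (Fin n × Fin d) (Fin m) Set.univ := measure_univ.symm
    _ ≤ _ := (measure_mono hcover).trans (measure_union_le _ _)
    _ ≤ _ := by gcongr

end Main

/-- Theorem 1.1 / spectral estimation: blockwise operator-norm error bound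
for the spectral estimator S⁰ = P_n(U) of the orthogonal matrices O_i. -/
theorem spectral_blockwise_error :
    ∃ c C : ℝ, 0 < c ∧ 0 < C ∧
      ∀ (n d m : ℕ), 1 ≤ n → 1 ≤ d → d ≤ m →
      ∀ A : Matrix (Fin d) (Fin m) ℝ, 0 < sigmaMin A →
      ∀ O : Fin n → Matrix (Fin d) (Fin d) ℝ, (∀ i, IsOrth (O i)) →
      ∀ σ γ : ℝ, 0 < σ → 2 ≤ γ →
      σ ≤ c * (sigmaMin A / kappa A ^ 4) * Real.sqrt (n : ℝ) / bnd1 n d m γ →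
      ENNReal.ofReal (1 - C * (n : ℝ) ^ (-γ + 2)) ≤
        stdGaussian (Fin n × Fin d) (Fin m) {W |
          ∀ U S0 : Matrix (Fin n × Fin d) (Fin d) ℝ,
            IsTopSingVecs (stack O * A + σ • Matrix.of W) U →
            IsPolarBlocks U S0 →
            ∃ Q : Matrix (Fin d) (Fin d) ℝ, IsOrth Q ∧
              ∀ i, opNorm (blk S0 i - O i * Q) ≤
                C * (σ * kappa A ^ 2 / sigmaMin A) * bnd1 n d m γ / Real.sqrt (n : ℝ)} := by
  refine ⟨1 / 1000, 3000, by norm_num, by norm_num, ?_⟩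
  intro n d m hn hd hdm A hA O hO σ γ hσ hγ hnoise
  rcases hn.eq_or_lt with rfl | hn
  · rw [ENNReal.ofReal_of_nonpos (by norm_num)]
    exact zero_le
  · have : NeZero d := ⟨by omega⟩
    exact stdGaussian_spectral_good_event hn hdm hA hO hσ (by linarith) hnoise

end GOPP
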